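/- arXiv:2210.12291 — 8 statements merged into one kernel-verified Lean document; each statement's English description precedes it below -/
import Mathlib

section
/- Let $a, b, k$ be positive integers with $a \ge 2k$ and $b \ge 2k$. Then the rainbow $k$-connection number of the complete bipartite graph $K_{a,b}$ satisfies $\mathrm{rc}_k(K_{a,b}) \le 4$; that is, there exists an edge coloring of $K_{a,b}$ with $4$ colors under which every pair of distinct vertices is connected by $k$ pairwise internally disjoint rainbow paths. -/
open SimpleGraph

/-- A walk in an edge-colored graph is *rainbow* (under the edge coloring `c`) if no color
appears on more than one of its edges. -/
def SimpleGraph.Walk.IsRainbow {V α : Type*} {G : SimpleGraph V} {u v : V}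
    (c : Sym2 V → α) (p : G.Walk u v) : Prop :=
  (p.edges.map c).Nodup

/-- The edge coloring `c` makes `G` *rainbow `k`-connected*: every pair of distinct vertices
is connected by `k` pairwise distinct, pairwise internally vertex-disjoint rainbow paths. -/
def IsRainbowConnectedColoring {V α : Type*} (G : SimpleGraph V) (k : ℕ)
    (c : Sym2 V → α) : Prop :=
  ∀ u v : V, u ≠ v → ∃ P : Fin k → G.Walk u v,
    Function.Injective P ∧
    (∀ i, (P i).IsPath ∧ (P i).IsRainbow c) ∧
    (∀ i j, i ≠ j → ∀ w, w ∈ (P i).support → w ∈ (P j).support → w = u ∨ w = v)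

/-- `RCle G k ℓ` says that the rainbow `k`-connection number of `G` is at most `ℓ`, i.e.
there is an edge coloring with `ℓ` colors making `G` rainbow `k`-connected. -/
def RCle {V : Type*} (G : SimpleGraph V) (k ℓ : ℕ) : Prop :=
  ∃ c : Sym2 V → Fin ℓ, IsRainbowConnectedColoring G k c


/-- The four colors, indexed by pairs of classes. -/
def rcCol : Bool → Bool → Fin 4
  | false, false => 0
  | false, true => 1
  | true, false => 2
  | true, true => 3

/-- Color of an (unordered) pair, given classes of vertices on both sides. -/
def rcFun {A B : Type*} (ca : A → Bool) (cb : B → Bool) : A ⊕ B → A ⊕ B → Fin 4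
  | .inl x, .inr y => rcCol (ca x) (cb y)
  | .inr y, .inl x => rcCol (ca x) (cb y)
  | _, _ => 0

/-- The edge coloring. -/
def rcColoring {A B : Type*} (ca : A → Bool) (cb : B → Bool) : Sym2 (A ⊕ B) → Fin 4 :=
  Sym2.lift ⟨rcFun ca cb, by rintro (x | x) (y | y) <;> rfl⟩

theorem rcColoring_lr {A B : Type*} (ca : A → Bool) (cb : B → Bool) (x : A) (y : B) :
    rcColoring ca cb s(.inl x, .inr y) = rcCol (ca x) (cb y) := rfl

theorem rcColoring_rl {A B : Type*} (ca : A → Bool) (cb : B → Bool) (x : A) (y : B) :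
    rcColoring ca cb s(.inr y, .inl x) = rcCol (ca x) (cb y) := rfl

/-- Injectivity of the path family follows from internal disjointness. -/
theorem rc_family {V α : Type*} {G : SimpleGraph V} {k : ℕ} {c : Sym2 V → α} {u v : V}
    (P : Fin k → G.Walk u v)
    (hint : ∀ i, ∃ w ∈ (P i).support, w ≠ u ∧ w ≠ v)
    (hP : ∀ i, (P i).IsPath ∧ (P i).IsRainbow c)
    (hd : ∀ i j, i ≠ j → ∀ w, w ∈ (P i).support → w ∈ (P j).support → w = u ∨ w = v) :
    ∃ P : Fin k → G.Walk u v,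
    Function.Injective P ∧
    (∀ i, (P i).IsPath ∧ (P i).IsRainbow c) ∧
    (∀ i j, i ≠ j → ∀ w, w ∈ (P i).support → w ∈ (P j).support → w = u ∨ w = v) := by
  refine ⟨P, ?_, hP, hd⟩
  intro i j hij
  by_contra hne
  obtain ⟨w, hw, h1, h2⟩ := hint i
  rcases hd i j hne w hw (hij ▸ hw) with h | h
  · exact h1 h
  · exact h2 h

theorem rc_main {A B : Type*} {k : ℕ} (ca : A → Bool) (cb : B → Bool)
    (pa : Bool → Fin k → A) (pb : Bool → Fin k → B)
    (hca : ∀ s i, ca (pa s i) = s) (hcb : ∀ s i, cb (pb s i) = s)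
    (ha : ∀ s, Function.Injective (pa s)) (hb : ∀ s, Function.Injective (pb s)) :
    IsRainbowConnectedColoring (completeBipartiteGraph A B) k (rcColoring ca cb) := by
  have adj1 : ∀ x y, (completeBipartiteGraph A B).Adj (.inl x) (.inr y) := by
    intro x y; simp
  have adj2 : ∀ x y, (completeBipartiteGraph A B).Adj (.inr y) (.inl x) := by
    intro x y; simp
  have nea : ∀ x s i, ca x ≠ s → x ≠ pa s i := by
    rintro x s i h rfl; exact h (hca s i)
  have neb : ∀ x s i, cb x ≠ s → x ≠ pb s i := by
    rintro x s i h rfl; exact h (hcb s i)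
  have ne2a : ∀ i j, pa false i ≠ pa true j := fun i j => nea _ _ _ (by simp [hca])
  have ne2b : ∀ i j, pb false i ≠ pb true j := fun i j => neb _ _ _ (by simp [hcb])
  have lr : ∀ (x : A) (y : B), ∃ P : Fin k → (completeBipartiteGraph A B).Walk (.inl x) (.inr y),
      Function.Injective P ∧ (∀ i, (P i).IsPath ∧ (P i).IsRainbow (rcColoring ca cb)) ∧
      (∀ i j, i ≠ j → ∀ w, w ∈ (P i).support → w ∈ (P j).support → w = .inl x ∨ w = .inr y) := by
    intro x y
    have hx := fun i => nea x (!(ca x)) i (by simp)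
    have hy := fun i => neb y (!(cb y)) i (by simp)
    refine rc_family (fun i => .cons (adj1 x (pb (!(cb y)) i)) (.cons (adj2 (pa (!(ca x)) i) _)
      (.cons (adj1 _ y) .nil))) ?_ ?_ ?_
    · intro i
      exact ⟨.inr (pb (!(cb y)) i), by simp, by simp, by simpa using (hy i).symm⟩
    · intro i
      constructor
      · rw [Walk.isPath_def]
        simp [hx i, (hy i).symm]
      · simp only [Walk.IsRainbow, Walk.edges_cons, Walk.edges_nil, List.map, rcColoring_lr,
          rcColoring_rl, hca, hcb]
        cases ca x <;> cases cb y <;> decide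
    · intro i j hij w h1 h2
      have e1 := (ha (!(ca x))).ne hij
      have e2 := (hb (!(cb y))).ne hij
      simp only [Walk.support_cons, Walk.support_nil, List.mem_cons, List.not_mem_nil] at h1 h2
      grind
  rintro (x | x) (y | y) hxy
  · by_cases h : ca x = ca y
    · have hx := fun i => nea x (!(ca x)) i (by simp)
      have hy := fun i => nea y (!(ca x)) i (by simp [h])
      refine rc_family (fun i => .cons (adj1 x (pb false i)) (.cons (adj2 (pa (!(ca x)) i) _)
        (.cons (adj1 _ (pb true i)) (.cons (adj2 y _) .nil)))) ?_ ?_ ?_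
      · intro i
        exact ⟨.inr (pb false i), by simp, by simp, by simp⟩
      · intro i
        constructor
        · rw [Walk.isPath_def]
          have : x ≠ y := by simpa using hxy
          simp [hx i, (hy i).symm, ne2b, this]
        · simp only [Walk.IsRainbow, Walk.edges_cons, Walk.edges_nil, List.map, rcColoring_lr,
            rcColoring_rl, hca, hcb, ← h]
          cases ca x <;> decide
      · intro i j hij w h1 h2
        have e1 := (ha (!(ca x))).ne hij
        have e2 := (hb false).ne hij
        have e3 := (hb true).ne hij
        have e4 := ne2b i j
        have e5 := ne2b j i
        simp only [Walk.support_cons, Walk.support_nil, List.mem_cons, List.not_mem_nil] at h1 h2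
        grind
    · refine rc_family (fun i => .cons (adj1 x (pb false i)) (.cons (adj2 y _) .nil)) ?_ ?_ ?_
      · intro i
        exact ⟨.inr (pb false i), by simp, by simp, by simp⟩
      · intro i
        constructor
        · rw [Walk.isPath_def]
          have : x ≠ y := by simpa using hxy
          simp [this]
        · simp only [Walk.IsRainbow, Walk.edges_cons, Walk.edges_nil, List.map, rcColoring_lr,
            rcColoring_rl, hcb]
          revert h
          cases ca x <;> cases ca y <;> decide
      · intro i j hij w h1 h2
        have e2 := (hb false).ne hij
        simp only [Walk.support_cons, Walk.support_nil, List.mem_cons, List.not_mem_nil] at h1 h2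
        grind
  · exact lr x y
  · obtain ⟨P, h1, h2, h3⟩ := lr y x
    refine ⟨fun i => (P i).reverse, ?_, ?_, ?_⟩
    · intro i j hij
      exact h1 (Walk.reverse_injective hij)
    · intro i
      refine ⟨(h2 i).1.reverse, ?_⟩
      have := (h2 i).2
      simpa [Walk.IsRainbow, Walk.edges_reverse, List.map_reverse] using this
    · intro i j hij w hw hw'
      simp only [Walk.support_reverse, List.mem_reverse] at hw hw'
      exact (h3 i j hij w hw hw').symm
  · by_cases h : cb x = cb y
    · have hx := fun i => neb x (!(cb x)) i (by simp)
      have hy := fun i => neb y (!(cb x)) i (by simp [h])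
      refine rc_family (fun i => .cons (adj2 (pa false i) x) (.cons (adj1 _ (pb (!(cb x)) i))
        (.cons (adj2 (pa true i) _) (.cons (adj1 _ y) .nil)))) ?_ ?_ ?_
      · intro i
        exact ⟨.inl (pa false i), by simp, by simp, by simp⟩
      · intro i
        constructor
        · rw [Walk.isPath_def]
          have : x ≠ y := by simpa using hxy
          simp [hx i, (hy i).symm, ne2a, this]
        · simp only [Walk.IsRainbow, Walk.edges_cons, Walk.edges_nil, List.map, rcColoring_lr,
            rcColoring_rl, hca, hcb, ← h]
          cases cb x <;> decide
      · intro i j hij w h1 h2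
        have e1 := (hb (!(cb x))).ne hij
        have e2 := (ha false).ne hij
        have e3 := (ha true).ne hij
        have e4 := ne2a i j
        have e5 := ne2a j i
        simp only [Walk.support_cons, Walk.support_nil, List.mem_cons, List.not_mem_nil] at h1 h2
        grind
    · refine rc_family (fun i => .cons (adj2 (pa false i) x) (.cons (adj1 _ y) .nil)) ?_ ?_ ?_
      · intro i
        exact ⟨.inl (pa false i), by simp, by simp, by simp⟩
      · intro i
        constructor
        · rw [Walk.isPath_def]
          have : x ≠ y := by simpa using hxy
          simp [this]
        · simp only [Walk.IsRainbow, Walk.edges_cons, Walk.edges_nil, List.map, rcColoring_lr,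
            rcColoring_rl, hca]
          revert h
          cases cb x <;> cases cb y <;> decide
      · intro i j hij w h1 h2
        have e2 := (ha false).ne hij
        simp only [Walk.support_cons, Walk.support_nil, List.mem_cons, List.not_mem_nil] at h1 h2
        grind

theorem rc_split (a k : ℕ) (h : 2 * k ≤ a) :
    ∃ (c : Fin a → Bool) (p : Bool → Fin k → Fin a),
      (∀ s i, c (p s i) = s) ∧ ∀ s, Function.Injective (p s) := by
  refine ⟨fun x => decide (k ≤ x.val),
    fun s i => ⟨if s then k + i.val else i.val, by split <;> omega⟩, ?_, ?_⟩
  · rintro (_ | _) i <;> simp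
  · rintro (_ | _) i j hij <;> simpa [Fin.ext_iff] using hij

/-- If `a, b ≥ 2k`, then `rc_k(K_{a,b}) ≤ 4`. -/
theorem rc_k_complete_bipartite_le_four (a b k : ℕ) (ha : 0 < a) (hb : 0 < b) (hk : 0 < k)
    (h2a : 2 * k ≤ a) (h2b : 2 * k ≤ b) :
    RCle (completeBipartiteGraph (Fin a) (Fin b)) k 4 := by
  obtain ⟨ca, pa, h1, h2⟩ := rc_split a k h2a
  obtain ⟨cb, pb, h3, h4⟩ := rc_split b k h2b
  exact ⟨rcColoring ca cb, rc_main ca cb pa pb h1 h3 h2 h4⟩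
end

section
/- Let $k, t, a_1, a_2, \dots, a_t$ be positive integers such that $t \ge 3$ is odd and $\frac{2k}{t-1} \le a_1 \le a_2 \le \dots \le a_t$. Then the rainbow $k$-connection number of the complete $t$-partite graph $K_{a_1, a_2, \dots, a_t}$ satisfies $\mathrm{rc}_k(K_{a_1, a_2, \dots, a_t}) \le 3$. -/
open SimpleGraph

/-- Color of the edges between two given parts. -/
def partCol (n n' : ℕ) : ℕ := if n / 2 = n' / 2 then 0 else 1 + (n + n') % 2

lemma partCol_lt (n n' : ℕ) : partCol n n' < 3 := by
  unfold partCol; split_ifs <;> omega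

lemma partCol_comm (n n' : ℕ) : partCol n n' = partCol n' n := by
  unfold partCol; rw [Nat.add_comm n n']; simp only [eq_comm]

lemma partCol_spec (n n' : ℕ) :
    (n / 2 = n' / 2 ∧ partCol n n' = 0) ∨
    (n / 2 ≠ n' / 2 ∧ partCol n n' = 1 + (n + n') % 2) := by
  unfold partCol; split_ifs <;> simp_all

/-- The other element of the pair `{2p, 2p+1}` containing `n`. -/
def flipPart (n : ℕ) : ℕ := 2 * (n / 2) + (1 - n % 2)

/-- First intermediate part of the `r`-th route from part `i` to part `j`. -/
def routeX (m i j r : ℕ) : ℕ :=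
  if r = i / 2 then
    (if r = j / 2 then (if i = j then flipPart i else 2 * m) else flipPart i)
  else if r = j / 2 then flipPart j else 2 * r

/-- Second intermediate part (equal to the first if the route has length two). -/
def routeY (m i j r : ℕ) : ℕ :=
  if r = i / 2 then
    (if r = j / 2 then 2 * m else flipPart i)
  else if r = j / 2 then flipPart j else if i % 2 = j % 2 then 2 * r + 1 else 2 * r

lemma route_bounds (m i j r : ℕ) (hi : i < 2 * m + 1) (hj : j < 2 * m + 1) (hr : r < m) :
    routeX m i j r < 2 * m + 1 ∧ routeY m i j r < 2 * m + 1 ∧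
    routeX m i j r ≠ i ∧ routeX m i j r ≠ j ∧ routeY m i j r ≠ i ∧ routeY m i j r ≠ j := by
  unfold routeX routeY flipPart
  split_ifs <;> omega

lemma route_disj (m i j r s : ℕ)
    (hr : r < m) (hs : s < m) (hrs : r ≠ s) :
    routeX m i j r ≠ routeX m i j s ∧ routeX m i j r ≠ routeY m i j s ∧
    routeY m i j r ≠ routeX m i j s ∧ routeY m i j r ≠ routeY m i j s := by
  unfold routeX routeY flipPart
  refine ⟨?_, ?_, ?_, ?_⟩ <;> split_ifs <;> omega

lemma route_col (m i j r : ℕ) (hi : i < 2 * m + 1) (hj : j < 2 * m + 1) (hr : r < m) :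
    (routeX m i j r = routeY m i j r ∧
      partCol i (routeX m i j r) ≠ partCol (routeX m i j r) j) ∨
    (routeX m i j r ≠ routeY m i j r ∧
      partCol i (routeX m i j r) ≠ partCol (routeX m i j r) (routeY m i j r) ∧
      partCol i (routeX m i j r) ≠ partCol (routeY m i j r) j ∧
      partCol (routeX m i j r) (routeY m i j r) ≠ partCol (routeY m i j r) j) := by
  have hb := route_bounds m i j r hi hj hr
  obtain ⟨x, hx⟩ : ∃ x, x = routeX m i j r := ⟨_, rfl⟩
  obtain ⟨y, hy⟩ : ∃ y, y = routeY m i j r := ⟨_, rfl⟩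
  rw [← hx, ← hy] at hb ⊢
  unfold routeX flipPart at hx
  unfold routeY flipPart at hy
  have s1 := partCol_spec i x
  have s2 := partCol_spec x j
  have s3 := partCol_spec x y
  have s4 := partCol_spec y j
  generalize partCol i x = c1 at *
  generalize partCol x j = c2 at *
  generalize partCol x y = c3 at *
  generalize partCol y j = c4 at *
  by_cases hxy : x = y
  · refine .inl ⟨hxy, ?_⟩
    clear s3 s4
    split_ifs at hx hy <;> omega
  · refine .inr ⟨hxy, ?_⟩
    clear s2
    split_ifs at hx hy <;> refine ⟨?_, ?_, ?_⟩ <;> omega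

theorem rc_k_odd_multipartite_le_three (k t : ℕ) (a : Fin t → ℕ)
    (hk : 0 < k) (ht : 3 ≤ t) (htodd : Odd t)
    (hapos : ∀ i, 0 < a i) (hmono : Monotone a)
    (hlb : 2 * k ≤ a ⟨0, by omega⟩ * (t - 1)) :
    RCle (completeMultipartiteGraph (fun i => Fin (a i))) k 3 := by
  obtain ⟨m, rfl⟩ := htodd
  obtain ⟨b, hb⟩ : ∃ b, b = a ⟨0, by omega⟩ := ⟨_, rfl⟩
  have hb0 : 0 < b := hb ▸ hapos _
  have hle : ∀ i, b ≤ a i := fun i => hb ▸ hmono (Fin.mk_le_of_le_val (Nat.zero_le _))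
  have hkm : k ≤ m * b := by
    rw [← hb, Nat.add_sub_cancel] at hlb
    nlinarith
  clear hlb
  refine ⟨Sym2.lift ⟨fun p q => ⟨partCol p.1 q.1, partCol_lt _ _⟩, fun p q => by
    simp [partCol_comm]⟩, ?_⟩
  intro u v huv
  have hdiv : ∀ n : Fin k, n.1 / b < m := fun n =>
    Nat.div_lt_of_lt_mul (by rw [Nat.mul_comm]; exact lt_of_lt_of_le n.2 hkm)
  have hmod : ∀ n : Fin k, n.1 % b < b := fun n => Nat.mod_lt _ hb0
  have hB := fun n : Fin k => route_bounds m u.1 v.1 (n.1 / b) u.1.2 v.1.2 (hdiv n)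
  let X : Fin k → (Σ i, Fin (a i)) := fun n =>
    ⟨⟨routeX m u.1 v.1 (n.1 / b), (hB n).1⟩, ⟨n.1 % b, (hmod n).trans_le (hle _)⟩⟩
  let Y : Fin k → (Σ i, Fin (a i)) := fun n =>
    ⟨⟨routeY m u.1 v.1 (n.1 / b), (hB n).2.1⟩, ⟨n.1 % b, (hmod n).trans_le (hle _)⟩⟩
  have hsep : ∀ n n' : Fin k, n ≠ n' →
      X n ≠ X n' ∧ X n ≠ Y n' ∧ Y n ≠ X n' ∧ Y n ≠ Y n' := by
    intro n n' hne
    by_cases hd : n.1 / b = n'.1 / b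
    · have hm : n.1 % b ≠ n'.1 % b := fun hm => hne (Fin.ext (by
        rw [← Nat.div_add_mod n.1 b, ← Nat.div_add_mod n'.1 b, hd, hm]))
      have key : ∀ p q : (Σ i, Fin (a i)), p.2.1 ≠ q.2.1 → p ≠ q := by
        rintro p q h rfl; exact h rfl
      exact ⟨key _ _ hm, key _ _ hm, key _ _ hm, key _ _ hm⟩
    · have h := route_disj m u.1 v.1 _ _ (hdiv n) (hdiv n') hd
      have key : ∀ p q : (Σ i, Fin (a i)), p.1.1 ≠ q.1.1 → p ≠ q := by
        rintro p q h rfl; exact h rfl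
      exact ⟨key _ _ h.1, key _ _ h.2.1, key _ _ h.2.2.1, key _ _ h.2.2.2⟩
  have hXu : ∀ n, (X n).1 ≠ u.1 := fun n h => (hB n).2.2.1 (congrArg Fin.val h)
  have hXv : ∀ n, (X n).1 ≠ v.1 := fun n h => (hB n).2.2.2.1 (congrArg Fin.val h)
  have hYu : ∀ n, (Y n).1 ≠ u.1 := fun n h => (hB n).2.2.2.2.1 (congrArg Fin.val h)
  have hYv : ∀ n, (Y n).1 ≠ v.1 := fun n h => (hB n).2.2.2.2.2 (congrArg Fin.val h)
  have key : ∀ p q : (Σ i, Fin (a i)), p.1 ≠ q.1 → p ≠ q := by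
    rintro p q h rfl; exact h rfl
  have hW : ∀ n : Fin k, ∃ P : (completeMultipartiteGraph (fun i => Fin (a i))).Walk u v,
      (P.IsPath ∧ P.IsRainbow (Sym2.lift ⟨fun p q => (⟨partCol p.1 q.1, partCol_lt _ _⟩ : Fin 3),
        fun p q => by simp [partCol_comm]⟩)) ∧ X n ∈ P.support ∧
      ∀ w ∈ P.support, w = u ∨ w = v ∨ w = X n ∨ w = Y n := by
    intro n
    have e1 := key _ _ (hXu n)
    have e2 := key _ _ (hXv n)
    have e3 := key _ _ (hYu n)
    have e4 := key _ _ (hYv n)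
    have a1 : (completeMultipartiteGraph (fun i => Fin (a i))).Adj u (X n) := (hXu n).symm
    have a2 : (completeMultipartiteGraph (fun i => Fin (a i))).Adj (X n) v := hXv n
    have a3 : (completeMultipartiteGraph (fun i => Fin (a i))).Adj (Y n) v := hYv n
    rcases route_col m u.1 v.1 (n.1 / b) u.1.2 v.1.2 (hdiv n) with ⟨_, hc⟩ | ⟨hxy, c1, c2, c3⟩
    · refine ⟨.cons a1 (.cons a2 .nil), ⟨?_, ?_⟩, by simp, ?_⟩
      · simp [Walk.cons_isPath_iff, e2, e1.symm, huv]
      · simpa [Walk.IsRainbow, X] using hc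
      · intro w hw; simp at hw; tauto
    · have hne : (X n).1 ≠ (Y n).1 := fun h => hxy (congrArg Fin.val h)
      have e5 := key _ _ hne
      have a4 : (completeMultipartiteGraph (fun i => Fin (a i))).Adj (X n) (Y n) := hne
      refine ⟨.cons a1 (.cons a4 (.cons a3 .nil)), ⟨?_, ?_⟩, by simp, ?_⟩
      · simp [Walk.cons_isPath_iff, e2, e1.symm, e3.symm, e4, e5, huv]
      · simpa [Walk.IsRainbow, X, Y] using ⟨⟨c1, c2⟩, c3⟩
      · intro w hw; simp at hw; tauto
  choose P hP hX hS using hW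
  have hdisj : ∀ i j, i ≠ j → ∀ w, w ∈ (P i).support → w ∈ (P j).support → w = u ∨ w = v := by
    intro i j hij w hi hj
    have h := hsep i j hij
    rcases hS i w hi with h1 | h1 | h1 | h1
    · exact .inl h1
    · exact .inr h1
    all_goals
      rcases hS j w hj with h2 | h2 | h2 | h2
      · exact .inl h2
      · exact .inr h2
      · exact absurd (h1.symm.trans h2) (by tauto)
      · exact absurd (h1.symm.trans h2) (by tauto)
  refine ⟨P, ?_, hP, hdisj⟩
  intro i j hij
  by_contra hne
  rcases hdisj i j hne (X i) (hX i) (hij ▸ hX i) with h | h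
  · exact key _ _ (hXu i) h
  · exact key _ _ (hXv i) h
end

section
/- Let $k, s, m$ be positive integers with $k \le s \le 2k - 1$ and $m \ge 4^{s} + 1$. Then the rainbow $k$-connection number of the complete bipartite graph $K_{s,m}$ satisfies $\mathrm{rc}_k(K_{s,m}) \ge 5$; that is, no edge coloring of $K_{s,m}$ with $4$ colors makes $K_{s,m}$ rainbow $k$-connected. -/
open SimpleGraph

theorem exists_first_edge {s m : ℕ} {a b : Fin m}
    (p : (completeBipartiteGraph (Fin s) (Fin m)).Walk (Sum.inr a) (Sum.inr b)) (hab : a ≠ b) :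
    ∃ x : Fin s, s(Sum.inr a, Sum.inl x) ∈ p.edges ∧ Sum.inl x ∈ p.support := by
  cases p with
  | nil => exact absurd rfl hab
  | @cons _ v _ h q =>
    rcases v with x | y
    · exact ⟨x, by simp, by simp⟩
    · simp [completeBipartiteGraph] at h

theorem exists_last_edge {s m : ℕ} {a b : Fin m}
    (p : (completeBipartiteGraph (Fin s) (Fin m)).Walk (Sum.inr a) (Sum.inr b)) (hab : a ≠ b) :
    ∃ x : Fin s, s(Sum.inr b, Sum.inl x) ∈ p.edges ∧ Sum.inl x ∈ p.support := by
  obtain ⟨x, h1, h2⟩ := exists_first_edge p.reverse hab.symm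
  exact ⟨x, by simpa using h1, by simpa using h2⟩

/-- If `k ≤ s ≤ 2k - 1` and `m ≥ 4^s + 1`, then `rc_k(K_{s,m}) ≥ 5`:
no edge coloring of `K_{s,m}` with `4` colors makes it rainbow `k`-connected. -/
theorem rc_k_complete_bipartite_ge_five (k s m : ℕ) (hk : 0 < k)
    (hks : k ≤ s) (hs : s ≤ 2 * k - 1) (hm : 4 ^ s + 1 ≤ m) :
    ¬ RCle (completeBipartiteGraph (Fin s) (Fin m)) k 4 := by
  rintro ⟨c, hc⟩
  obtain ⟨a, b, hab, hcol⟩ := Fintype.exists_ne_map_eq_of_card_lt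
    (fun (a : Fin m) (x : Fin s) => c s(Sum.inr a, Sum.inl x)) (by simp; omega)
  obtain ⟨P, -, hP, hd⟩ := hc (Sum.inr a) (Sum.inr b) (by simpa using hab)
  choose f hf1 hf2 using fun i => exists_first_edge (P i) hab
  choose g hg1 hg2 using fun i => exists_last_edge (P i) hab
  have hfg : ∀ i, f i ≠ g i := by
    intro i h
    have hg := hg1 i
    rw [← h] at hg
    have := List.inj_on_of_nodup_map (hP i).2 (hf1 i) hg (congrFun hcol (f i))
    simp [hab] at this
  have key : ∀ i j (x : Fin s), Sum.inl x ∈ (P i).support → Sum.inl x ∈ (P j).support → i = j := by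
    intro i j x h1 h2
    by_contra hij
    simpa using hd i j hij _ h1 h2
  have hinj : Function.Injective (Sum.elim f g) := by
    rintro (i | i) (j | j) h <;> simp only [Sum.elim_inl, Sum.elim_inr] at h
    · rw [key i j (f i) (hf2 i) (h ▸ hf2 j)]
    · have e := key i j (f i) (hf2 i) (h ▸ hg2 j)
      subst e
      exact absurd h (hfg i)
    · have e := key i j (g i) (hg2 i) (h ▸ hf2 j)
      subst e
      exact absurd h.symm (hfg i)
    · rw [key i j (g i) (hg2 i) (h ▸ hg2 j)]
  have := Fintype.card_le_of_injective _ hinj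
  simp at this
  omega
end

section
/- Let $k, t, s_1, s_2, \dots, s_{t-1}, m$ be positive integers with $t \ge 3$, with $\frac{k}{t-1} \le s_i \le \left\lceil \frac{2k}{t-1} \right\rceil - 1$ for every $i \in \{1, \dots, t-1\}$, and with $m \ge 3^{s_1 + s_2 + \dots + s_{t-1}} + 1$. Let $K$ denote the complete $t$-partite graph with parts of sizes $m, s_1, s_2, \dots, s_{t-1}$. Then $\mathrm{rc}_k(K) \ge 4$; that is, no edge coloring of $K$ with $3$ colors makes $K$ rainbow $k$-connected. -/
open SimpleGraph

/-- Between two vertices of part `0` seeing all other vertices with the same colors, every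
rainbow path with three colors has two distinct internal vertices outside part `0`. -/
lemma rainbow_path_aux {T : ℕ} {n : Fin (T + 1) → ℕ}
    (c : Sym2 (Σ i, Fin (n i)) → Fin 3) (u v : Σ i, Fin (n i)) (huv : u ≠ v)
    (hu : u.1 = 0) (hv : v.1 = 0)
    (hc : ∀ w : Σ i, Fin (n i), w.1 ≠ 0 → c s(u, w) = c s(v, w))
    (p : (completeMultipartiteGraph (fun i => Fin (n i))).Walk u v)
    (hp : p.IsPath) (hr : p.IsRainbow c) :
    ∃ a b : Σ i, Fin (n i), a ≠ b ∧ a.1 ≠ 0 ∧ b.1 ≠ 0 ∧ a ∈ p.support ∧ b ∈ p.support := by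
  unfold SimpleGraph.Walk.IsRainbow at hr
  cases p with
  | nil => exact absurd rfl huv
  | @cons _ a _ h q =>
    have ha : a.1 ≠ 0 := by
      have h1 : u.1 ≠ a.1 := h
      rw [hu] at h1
      exact h1.symm
    cases q with
    | nil => exact absurd hv ha
    | @cons _ b _ h2 r =>
      cases r with
      | nil =>
        exfalso
        have := hc a ha
        rw [Sym2.eq_swap (a := v)] at this
        simp [this] at hr
      | @cons _ d _ h3 r' =>
        cases r' with
        | nil =>
          have hb : b.1 ≠ 0 := by
            have h1 : b.1 ≠ v.1 := h3
            rwa [hv] at h1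
          refine ⟨a, b, h2.ne, ha, hb, ?_, ?_⟩ <;> simp
        | cons h4 r'' =>
          exfalso
          have := hr.length_le_card
          simp at this
          omega

/-- Let `t ≥ 3`, let `s i` (for `i : Fin (t-1)`) satisfy
`k/(t-1) ≤ s i ≤ ⌈2k/(t-1)⌉ - 1` (the lower bound is expressed as `k ≤ s i * (t-1)`),
and let `m ≥ 3^(s 0 + ⋯ + s (t-2)) + 1`.  If `K` is the complete `t`-partite graph with
parts of sizes `m, s 0, …, s (t-2)`, then `rc_k(K) ≥ 4`: no edge coloring with `3` colors
makes `K` rainbow `k`-connected. -/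
theorem rc_k_multipartite_ge_four (k t m : ℕ) (s : Fin (t - 1) → ℕ) (n : Fin t → ℕ)
    (hk : 0 < k) (ht : 3 ≤ t) (hm : 0 < m)
    (hspos : ∀ i, 0 < s i)
    (hslb : ∀ i, k ≤ s i * (t - 1))
    (hsub : ∀ i, s i ≤ ⌈(2 * k : ℚ) / ((t : ℚ) - 1)⌉₊ - 1)
    (hmge : 3 ^ (∑ i, s i) + 1 ≤ m)
    (hn0 : n ⟨0, by omega⟩ = m)
    (hni : ∀ i : Fin (t - 1), n ⟨i.1 + 1, by have h := i.isLt; omega⟩ = s i) :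
    ¬ RCle (completeMultipartiteGraph (fun i => Fin (n i))) k 3 := by
  rintro ⟨c, hcol⟩
  obtain ⟨T, rfl⟩ : ∃ T, t = T + 1 := ⟨t - 1, by omega⟩
  change Fin T → ℕ at s
  have hs : ∀ i : Fin T, n i.succ = s i := fun i => hni i
  have hn0' : n 0 = m := hn0
  have hcardW : Fintype.card (Σ i : Fin T, Fin (n i.succ)) = ∑ i : Fin T, s i := by
    simp [hs]
  have hmge' : 3 ^ (∑ i : Fin T, s i) + 1 ≤ m := hmge
  -- pigeonhole
  obtain ⟨x, y, hxy, hf⟩ := Fintype.exists_ne_map_eq_of_card_lt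
    (fun (x : Fin (n 0)) (w : Σ i : Fin T, Fin (n i.succ)) =>
      c s((⟨0, x⟩ : Σ i, Fin (n i)), ⟨w.1.succ, w.2⟩)) (by
      simp only [Fintype.card_fun, Fintype.card_fin, hcardW, hn0']
      omega)
  have huv : (⟨0, x⟩ : Σ i, Fin (n i)) ≠ ⟨0, y⟩ := by
    intro h
    apply hxy
    simpa using h
  have lift : ∀ w : Σ i, Fin (n i), w.1 ≠ 0 →
      ∃ w' : Σ i : Fin T, Fin (n i.succ), (⟨w'.1.succ, w'.2⟩ : Σ i, Fin (n i)) = w := by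
    rintro ⟨i, w⟩ hi
    obtain ⟨j, rfl⟩ := Fin.exists_succ_eq.2 hi
    exact ⟨⟨j, w⟩, rfl⟩
  obtain ⟨P, -, hP, hdis⟩ := hcol _ _ huv
  have key : ∀ i, ∃ g : Bool → Σ i : Fin T, Fin (n i.succ), g true ≠ g false ∧
      ∀ b, (⟨(g b).1.succ, (g b).2⟩ : Σ i, Fin (n i)) ∈ (P i).support := by
    intro i
    obtain ⟨a, b, hab, ha, hb, has, hbs⟩ := rainbow_path_aux c _ _ huv rfl rfl (by
      intro w hw
      obtain ⟨w', rfl⟩ := lift w hw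
      exact congrFun hf w') (P i) (hP i).1 (hP i).2
    obtain ⟨a', rfl⟩ := lift a ha
    obtain ⟨b', rfl⟩ := lift b hb
    refine ⟨fun z => if z then a' else b', ?_, ?_⟩
    · intro h
      apply hab
      simp at h
      rw [h]
    · intro z
      cases z
      · simpa using hbs
      · simpa using has
  choose g hg hgs using key
  have hinj : Function.Injective (fun z : Fin k × Bool => g z.1 z.2) := by
    rintro ⟨i, b⟩ ⟨j, b'⟩ h
    simp only at h
    by_cases hij : i = j
    · subst hij
      have h1 := hg i
      cases b <;> cases b' <;> first | rfl | exact absurd h h1 | exact absurd h.symm h1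
    · exfalso
      have h1 := hgs i b
      have h2 := hgs j b'
      rw [← h] at h2
      rcases hdis i j hij _ h1 h2 with h3 | h3
      · exact Fin.succ_ne_zero _ (congrArg Sigma.fst h3)
      · exact Fin.succ_ne_zero _ (congrArg Sigma.fst h3)
  have hle := Fintype.card_le_of_injective _ hinj
  rw [hcardW] at hle
  simp only [Fintype.card_prod, Fintype.card_fin, Fintype.card_bool] at hle
  have hT : 0 < T := by omega
  have hTq : (0 : ℚ) < T := by exact_mod_cast hT
  have hlt : ∀ i : Fin T, s i * T < 2 * k := by
    intro i
    have h1 := hsub i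
    have h2 := hspos i
    have h3 : s i < ⌈(2 * k : ℚ) / (((T + 1 : ℕ) : ℚ) - 1)⌉₊ := by omega
    rw [Nat.lt_ceil] at h3
    push_cast at h3
    rw [add_sub_cancel_right, lt_div_iff₀ hTq] at h3
    exact_mod_cast h3
  have hsum : ∑ i : Fin T, s i * T < ∑ i : Fin T, 2 * k :=
    Finset.sum_lt_sum_of_nonempty ⟨⟨0, hT⟩, Finset.mem_univ _⟩ (fun i _ => hlt i)
  rw [← Finset.sum_mul, Finset.sum_const, Finset.card_univ, Fintype.card_fin, smul_eq_mul,
    mul_comm T] at hsum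
  have := Nat.lt_of_mul_lt_mul_right hsum
  omega
end

section
/- Let $k \ge 2$ and $t \ge 2$ be integers, and suppose $K_{n_1, \dots, n_t}$ is a complete $t$-partite graph with every part of size $n_i \ge \left\lceil \frac{2k}{t-1} \right\rceil$. Then $\mathrm{rc}_k(K_{n_1, \dots, n_t}) \le 4$ if $t = 2$, and $\mathrm{rc}_k(K_{n_1, \dots, n_t}) \le 3$ if $t \ge 3$. -/
open SimpleGraph

/-- There is a rainbow `u`-`v` path with nonempty interior contained in `T`. -/
def RLink {V α : Type*} (G : SimpleGraph V) (c : Sym2 V → α) (u v : V) (T : Set V) : Prop :=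
  ∃ p : G.Walk u v, p.IsPath ∧ p.IsRainbow c ∧
    (∀ w ∈ p.support, w = u ∨ w = v ∨ w ∈ T) ∧
    ∃ w ∈ p.support, w ∈ T ∧ w ≠ u ∧ w ≠ v

theorem RLink.two {V α : Type*} {G : SimpleGraph V} {c : Sym2 V → α} {u v x : V}
    (huv : u ≠ v) (h1 : G.Adj u x) (h2 : G.Adj x v) (hc : c s(u, x) ≠ c s(x, v)) :
    RLink G c u v {w | w = x} := by
  refine ⟨.cons h1 (.cons h2 .nil), ?_, ?_, ?_, x, ?_⟩
  · simp [Walk.isPath_def, h1.ne, h2.ne, huv]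
  · simpa [Walk.IsRainbow] using hc
  · simp; 
  · simp [h1.ne', h2.ne]

theorem RLink.three {V α : Type*} {G : SimpleGraph V} {c : Sym2 V → α} {u v x y : V}
    (huv : u ≠ v) (h1 : G.Adj u x) (h2 : G.Adj x y) (h3 : G.Adj y v)
    (hy : u ≠ y) (hx : x ≠ v)
    (c1 : c s(u, x) ≠ c s(x, y)) (c2 : c s(u, x) ≠ c s(y, v)) (c3 : c s(x, y) ≠ c s(y, v)) :
    RLink G c u v {w | w = x ∨ w = y} := by
  refine ⟨.cons h1 (.cons h2 (.cons h3 .nil)), ?_, ?_, ?_, x, ?_⟩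
  · simp [Walk.isPath_def, h1.ne, h2.ne, h3.ne, huv, hy, hx]
  · simp [Walk.IsRainbow, c1, c2, c3]
  · simp; 
  · simp [h1.ne', hx]

theorem RLink.four {V α : Type*} {G : SimpleGraph V} {c : Sym2 V → α} {u v x y z : V}
    (huv : u ≠ v) (h1 : G.Adj u x) (h2 : G.Adj x y) (h3 : G.Adj y z) (h4 : G.Adj z v)
    (hy : u ≠ y) (hz : u ≠ z) (hxz : x ≠ z) (hx : x ≠ v) (hyv : y ≠ v)
    (hc : [c s(u, x), c s(x, y), c s(y, z), c s(z, v)].Nodup) :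
    RLink G c u v {w | w = x ∨ w = y ∨ w = z} := by
  refine ⟨.cons h1 (.cons h2 (.cons h3 (.cons h4 .nil))), ?_, ?_, ?_, x, ?_⟩
  · simp [Walk.isPath_def, h1.ne, h2.ne, h3.ne, h4.ne, huv, hy, hz, hx, hyv, hxz]
  · simpa [Walk.IsRainbow] using hc
  · simp; 
  · simp [h1.ne', hx]

/-- The conclusion for a fixed pair of vertices. -/
def ManyPaths {V α : Type*} (G : SimpleGraph V) (k : ℕ) (c : Sym2 V → α) (u v : V) : Prop :=
  ∃ P : Fin k → G.Walk u v,
    Function.Injective P ∧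
    (∀ i, (P i).IsPath ∧ (P i).IsRainbow c) ∧
    (∀ i j, i ≠ j → ∀ w, w ∈ (P i).support → w ∈ (P j).support → w = u ∨ w = v)

theorem ManyPaths.of_links {V α : Type*} {G : SimpleGraph V} {c : Sym2 V → α} {u v : V} {k : ℕ}
    {ι : Type*} [Fintype ι] (hk : k ≤ Fintype.card ι) (T : ι → Set V)
    (hT : ∀ a, RLink G c u v (T a)) (hd : ∀ a b, a ≠ b → ∀ w, w ∈ T a → w ∉ T b) :
    ManyPaths G k c u v := by
  obtain ⟨e⟩ : Nonempty (Fin k ↪ ι) := by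
    apply Function.Embedding.nonempty_of_card_le; simpa using hk
  choose p hp using hT
  have key : ∀ i j, i ≠ j → ∀ w, w ∈ (p (e i)).support → w ∈ (p (e j)).support →
      w = u ∨ w = v := by
    intro i j hij w hw hw'
    have h1 := (hp (e i)).2.2.1 w hw
    have h2 := (hp (e j)).2.2.1 w hw'
    have h3 := hd _ _ (e.injective.ne hij) w
    tauto
  refine ⟨fun i => p (e i), ?_, fun i => ⟨(hp _).1, (hp _).2.1⟩, key⟩
  intro i j hij
  by_contra hne
  obtain ⟨w, hw, -, hu, hv⟩ := (hp (e i)).2.2.2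
  have hw' : w ∈ (p (e j)).support := by
    have : p (e i) = p (e j) := hij
    rw [← this]; exact hw
  have := key i j hne w hw hw'
  tauto

/-- The colour pattern on parts. -/
def pcol (i j : ℕ) : Fin 3 :=
  if i / 2 = j / 2 then 0 else if i % 2 = j % 2 then 1 else 2

theorem pcol_comm (i j : ℕ) : pcol i j = pcol j i := by
  unfold pcol; simp only [eq_comm]

/-- The colouring for `t ≥ 3`. -/
def vcol {t : ℕ} {n : Fin t → ℕ} : Sym2 (Σ i, Fin (n i)) → Fin 3 :=
  Sym2.lift ⟨fun u v => pcol u.1 v.1, fun _ _ => pcol_comm _ _⟩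

/-- The parts `w, z` can be used for the interior of a path from part `i` to part `j`. -/
def GP (i j w z : ℕ) : Prop :=
  w ≠ i ∧ w ≠ j ∧ z ≠ i ∧ z ≠ j ∧ ((w = z ∧ pcol i w ≠ pcol w j) ∨
    (w ≠ z ∧ pcol i w ≠ pcol w z ∧ pcol i w ≠ pcol z j ∧ pcol w z ≠ pcol z j))

theorem many_of_pairs {t : ℕ} {n : Fin t → ℕ} {k : ℕ} {u v : Σ i, Fin (n i)} (huv : u ≠ v)
    {ι : Type*} [Fintype ι] (hk : k ≤ Fintype.card ι) (X Y : ι → Σ i, Fin (n i))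
    (hg : ∀ a, GP u.1 v.1 (X a).1 (Y a).1)
    (hXY : ∀ a, (X a).1 = (Y a).1 → X a = Y a)
    (hd : ∀ a b, a ≠ b → X a ≠ X b ∧ X a ≠ Y b ∧ Y a ≠ Y b) :
    ManyPaths (completeMultipartiteGraph (fun i => Fin (n i))) k vcol u v := by
  refine ManyPaths.of_links hk (fun a => {w | w = X a ∨ w = Y a}) ?_ ?_
  · intro a
    obtain ⟨h1, h2, h3, h4, h⟩ := hg a
    have hux : u.1 ≠ (X a).1 := fun h => h1 (by rw [h])
    have huy : u.1 ≠ (Y a).1 := fun h => h3 (by rw [h])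
    have hvx : (X a).1 ≠ v.1 := fun h => h2 (by rw [h])
    have hvy : (Y a).1 ≠ v.1 := fun h => h4 (by rw [h])
    rcases h with ⟨h, hc⟩ | ⟨h, c1, c2, c3⟩
    · have := hXY a (Fin.ext h)
      rw [← this]
      simp only [or_self]
      exact RLink.two huv hux hvx hc
    · have hxy : (X a).1 ≠ (Y a).1 := fun e => h (by rw [e])
      exact RLink.three huv hux hxy hvy (fun e => huy (by rw [e])) (fun e => hvx (by rw [e]))
        c1 c2 c3
  · rintro a b hab w hw hw'
    have h1 := hd a b hab
    have h2 := hd b a hab.symm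
    change _ ∨ _ at hw hw'
    rcases hw with rfl | rfl <;> rcases hw' with h | h
    · exact h1.1 h
    · exact h1.2.1 h
    · exact h2.2.1 h.symm
    · exact h1.2.2 h

/-- Blow-up version: a family of disjoint pairs of parts, each used `s` times. -/
theorem many_of_blow {t : ℕ} {n : Fin t → ℕ} {k s : ℕ} (hs : ∀ i, s ≤ n i)
    {u v : Σ i, Fin (n i)} (huv : u ≠ v)
    {κ : Type*} [Fintype κ] (hk : k ≤ Fintype.card κ * s) (W Z : κ → Fin t)
    (hg : ∀ a, GP u.1 v.1 (W a) (Z a))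
    (hd : ∀ a b, a ≠ b → W a ≠ W b ∧ W a ≠ Z b ∧ Z a ≠ Z b) :
    ManyPaths (completeMultipartiteGraph (fun i => Fin (n i))) k vcol u v := by
  have ext' : ∀ (i j : Fin t) (x : Fin (n i)) (y : Fin (n j)), i = j → x.1 = y.1 →
      (⟨i, x⟩ : Σ i, Fin (n i)) = ⟨j, y⟩ := by
    rintro i j x y rfl h; rw [Fin.ext h]
  refine many_of_pairs (ι := κ × Fin s) huv (by simpa using hk)
    (fun a => ⟨W a.1, Fin.castLE (hs _) a.2⟩) (fun a => ⟨Z a.1, Fin.castLE (hs _) a.2⟩) ?_ ?_ ?_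
  · exact fun a => hg a.1
  · intro a h
    exact ext' _ _ _ _ h rfl
  · rintro ⟨a, x⟩ ⟨b, y⟩ hab
    by_cases h : a = b
    · subst h
      have hxy : x.1 ≠ y.1 := fun e => hab (by rw [Fin.ext e])
      have nx : ∀ (i j : Fin t),
          (⟨i, Fin.castLE (hs _) x⟩ : Σ i, Fin (n i)) ≠ ⟨j, Fin.castLE (hs _) y⟩ := by
        intro i j e
        obtain ⟨rfl, e2⟩ := Sigma.mk.inj_iff.1 e
        have e3 := congrArg Fin.val (eq_of_heq e2)
        exact hxy e3
      exact ⟨nx _ _, nx _ _, nx _ _⟩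
    · obtain ⟨h1, h2, h3⟩ := hd a b h
      exact ⟨fun e => h1 (congrArg Sigma.fst e), fun e => h2 (congrArg Sigma.fst e),
        fun e => h3 (congrArg Sigma.fst e)⟩

theorem GP.pair {i j q : ℕ} (h : i % 2 = j % 2) (hi : i / 2 ≠ q) (hj : j / 2 ≠ q) :
    GP i j (2 * q) (2 * q + 1) := by
  have a1 : (2 * q) / 2 = q := by omega
  have a2 : (2 * q + 1) / 2 = q := by omega
  have a3 : (2 * q) % 2 = 0 := by omega
  have a4 : (2 * q + 1) % 2 = 1 := by omega
  refine ⟨by omega, by omega, by omega, by omega, Or.inr ⟨by omega, ?_⟩⟩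
  unfold pcol
  simp only [a1, a2, a3, a4, ← h, hi, hj.symm, if_true, if_false]
  rcases Nat.mod_two_eq_zero_or_one i with e | e <;> simp [e]

theorem GP.single {i j w : ℕ} (h : i % 2 ≠ j % 2) (hi : w ≠ i) (hj : w ≠ j) :
    GP i j w w := by
  refine ⟨hi, hj, hi, hj, Or.inl ⟨rfl, ?_⟩⟩
  unfold pcol
  split_ifs <;> first | omega | decide

theorem GP.partner {i j : ℕ} (h : i % 2 = j % 2) (hij : i ≠ j) :
    GP i j (4 * (i / 2) + 1 - i) (4 * (i / 2) + 1 - i) := by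
  refine ⟨by omega, by omega, by omega, by omega, Or.inl ⟨rfl, ?_⟩⟩
  unfold pcol
  split_ifs <;> first | omega | decide

theorem GP.partner' {i j : ℕ} (h : i % 2 = j % 2) (hij : i ≠ j) :
    GP i j (4 * (j / 2) + 1 - j) (4 * (j / 2) + 1 - j) := by
  refine ⟨by omega, by omega, by omega, by omega, Or.inl ⟨rfl, ?_⟩⟩
  unfold pcol
  split_ifs <;> first | omega | decide

/-- partner of `i` together with any part outside the pair of `i`. -/
theorem GP.same {i w : ℕ} (h : i / 2 ≠ w / 2) :
    GP i i (4 * (i / 2) + 1 - i) w := by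
  refine ⟨by omega, by omega, by omega, by omega, Or.inr ⟨by omega, ?_⟩⟩
  unfold pcol
  split_ifs <;> first | omega | decide

theorem main_cross {t : ℕ} {n : Fin t → ℕ} {k s : ℕ} (ht : 3 ≤ t) (hs : ∀ i, s ≤ n i)
    (hk : k ≤ (t / 2) * s) {u v : Σ i, Fin (n i)} (h : u.1 ≠ v.1) :
    ManyPaths (completeMultipartiteGraph (fun i => Fin (n i))) k vcol u v := by
  have huv : u ≠ v := fun e => h (by rw [e])
  obtain ⟨⟨i, hi⟩, hu⟩ : ∃ i : Fin t, u.1 = i := ⟨_, rfl⟩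
  obtain ⟨⟨j, hj⟩, hv⟩ : ∃ i : Fin t, v.1 = i := ⟨_, rfl⟩
  have hij : i ≠ j := by
    rintro rfl; exact h (hu.trans hv.symm)
  by_cases hp : i % 2 = j % 2
  · refine many_of_blow hs huv (κ := Fin (t / 2)) (by simpa using hk)
      (fun q => ⟨if i / 2 = q.1 then 4 * (i / 2) + 1 - i else
        if j / 2 = q.1 then 4 * (j / 2) + 1 - j else 2 * q.1, ?_⟩)
      (fun q => ⟨if i / 2 = q.1 then 4 * (i / 2) + 1 - i else
        if j / 2 = q.1 then 4 * (j / 2) + 1 - j else 2 * q.1 + 1, ?_⟩) ?_ ?_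
    · have := q.2
      split_ifs <;> omega
    · have := q.2
      split_ifs <;> omega
    · intro q
      rw [hu, hv]
      dsimp only
      split_ifs with h1 h2
      · exact GP.partner hp hij
      · exact GP.partner' hp hij
      · exact GP.pair hp h1 h2
    · intro a b hab
      have : a.1 ≠ b.1 := fun e => hab (Fin.ext e)
      simp only [ne_eq, Fin.mk.injEq]
      split_ifs <;> omega
  · refine many_of_blow hs huv (κ := {w : Fin t // ¬ (w = ⟨i, hi⟩ ∨ w = ⟨j, hj⟩)}) ?_
      (fun w => w.1) (fun w => w.1) ?_ ?_
    · rw [Fintype.card_subtype_compl, Fintype.card_fin]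
      have : Fintype.card {w : Fin t // w = ⟨i, hi⟩ ∨ w = ⟨j, hj⟩} = 2 := by
        rw [Fintype.card_subtype]
        have : (Finset.univ.filter fun w : Fin t => w = ⟨i, hi⟩ ∨ w = ⟨j, hj⟩)
            = {⟨i, hi⟩, ⟨j, hj⟩} := by ext; simp
        rw [this, Finset.card_pair]
        simpa using hij
      rw [this]
      exact hk.trans (Nat.mul_le_mul_right _ (by omega))
    · rintro ⟨w, hw⟩
      rw [hu, hv]
      refine GP.single hp ?_ ?_
      · intro e; exact hw (Or.inl (Fin.ext e))
      · intro e; exact hw (Or.inr (Fin.ext e))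
    · intro a b hab
      have : a.1 ≠ b.1 := fun e => hab (Subtype.ext e)
      exact ⟨this, this, this⟩

theorem main_same_odd {t : ℕ} {n : Fin t → ℕ} {k s : ℕ} (hs : ∀ i, s ≤ n i)
    (hodd : t % 2 = 1)
    (hk : k ≤ (t / 2) * s) {u v : Σ i, Fin (n i)} (huv : u ≠ v) (h : u.1 = v.1) :
    ManyPaths (completeMultipartiteGraph (fun i => Fin (n i))) k vcol u v := by
  obtain ⟨⟨i, hi⟩, hu⟩ : ∃ i : Fin t, u.1 = i := ⟨_, rfl⟩
  have hv := h.symm.trans hu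
  refine many_of_blow hs huv (κ := Fin (t / 2)) (by simpa using hk)
      (fun q => ⟨if i / 2 = q.1 then 4 * (i / 2) + 1 - i else 2 * q.1, ?_⟩)
      (fun q => ⟨if i / 2 = q.1 then t - 1 else 2 * q.1 + 1, ?_⟩) ?_ ?_
  · have := q.2
    split_ifs <;> omega
  · have := q.2
    split_ifs <;> omega
  · intro q
    have := q.2
    rw [hu, hv]
    dsimp only
    split_ifs with h1
    · exact GP.same (by omega)
    · exact GP.pair rfl h1 h1
  · intro a b hab
    have : a.1 ≠ b.1 := fun e => hab (Fin.ext e)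
    have := a.2
    have := b.2
    simp only [ne_eq, Fin.mk.injEq]
    split_ifs <;> omega

theorem GP.symm_same {i w z : ℕ} (h : GP i i w z) : GP i i z w := by
  obtain ⟨h1, h2, h3, h4, h⟩ := h
  refine ⟨h3, h4, h1, h2, ?_⟩
  rcases h with ⟨rfl, h⟩ | ⟨a, b, c, d⟩
  · exact Or.inl ⟨rfl, h⟩
  · rw [pcol_comm i w] at *
    rw [pcol_comm z i] at *
    rw [pcol_comm w z] at *
    exact Or.inr ⟨a.symm, d.symm, c.symm, b.symm⟩

theorem main_same_even {t : ℕ} {n : Fin t → ℕ} {k s : ℕ} (hs : ∀ i, s ≤ n i)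
    (ht : 3 ≤ t) (heven : t % 2 = 0)
    (hk : k ≤ (t / 2 - 2) * s + (s + s / 2)) {u v : Σ i, Fin (n i)} (huv : u ≠ v)
    (h : u.1 = v.1) :
    ManyPaths (completeMultipartiteGraph (fun i => Fin (n i))) k vcol u v := by
  obtain ⟨⟨i, hi⟩, hu⟩ : ∃ i : Fin t, u.1 = i := ⟨_, rfl⟩
  have hv := h.symm.trans hu
  -- the other pair of the triangle
  obtain ⟨r, hr, hri⟩ : ∃ r, r < t / 2 ∧ i / 2 ≠ r := by
    by_cases h0 : i / 2 = 0
    · exact ⟨1, by omega, by omega⟩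
    · exact ⟨0, by omega, h0⟩
  have mk : ∀ (w x : ℕ), w < t → x < s → ∃ y : Σ i, Fin (n i), y.1.1 = w ∧ y.2.1 = x :=
    fun w x hw hx => ⟨⟨⟨w, hw⟩, ⟨x, hx.trans_le (hs _)⟩⟩, rfl, rfl⟩
  have ne' : ∀ (y z : Σ i, Fin (n i)), (y.1.1 ≠ z.1.1 ∨ y.2.1 ≠ z.2.1) → y ≠ z := by
    rintro y z h rfl; simp at h
  have hcard : Fintype.card {q : Fin (t / 2) // ¬ (q.1 = i / 2 ∨ q.1 = r)} = t / 2 - 2 := by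
    rw [Fintype.card_subtype_compl, Fintype.card_fin, Fintype.card_subtype]
    have hi2 : i / 2 < t / 2 := by omega
    have : (Finset.univ.filter fun q : Fin (t / 2) => q.1 = i / 2 ∨ q.1 = r)
        = {⟨i / 2, hi2⟩, ⟨r, hr⟩} := by ext; simp [Fin.ext_iff]
    rw [this, Finset.card_pair]
    simpa using hri
  -- the numerical description of the family
  obtain ⟨p, hpdef⟩ : ∃ p, p = 4 * (i / 2) + 1 - i := ⟨_, rfl⟩
  have hX : ∀ a : (({q : Fin (t / 2) // ¬ (q.1 = i / 2 ∨ q.1 = r)} × Fin s) ⊕ (Fin (s - s / 2) ⊕ (Fin (s / 2) ⊕ Fin (s / 2)))), ∃ y z : Σ i, Fin (n i),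
      match a with
      | .inl (q, x) => (y.1.1 = 2 * q.1.1 ∧ y.2.1 = x.1) ∧ (z.1.1 = 2 * q.1.1 + 1 ∧ z.2.1 = x.1)
      | .inr (.inl x) => (y.1.1 = p ∧ y.2.1 = x.1) ∧ (z.1.1 = 2 * r ∧ z.2.1 = x.1)
      | .inr (.inr (.inl x)) => (y.1.1 = 2 * r ∧ y.2.1 = s - s / 2 + x.1) ∧
          (z.1.1 = 2 * r + 1 ∧ z.2.1 = x.1)
      | .inr (.inr (.inr x)) => (y.1.1 = p ∧ y.2.1 = s - s / 2 + x.1) ∧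
          (z.1.1 = 2 * r + 1 ∧ z.2.1 = s / 2 + x.1) := by
    rintro (⟨⟨q, hq⟩, x⟩ | x | x | x)
    · obtain ⟨y, hy⟩ := mk (2 * q.1) x.1 (by omega) (by omega)
      obtain ⟨z, hz⟩ := mk (2 * q.1 + 1) x.1 (by omega) (by omega)
      exact ⟨y, z, hy, hz⟩
    · obtain ⟨y, hy⟩ := mk p x.1 (by omega) (by omega)
      obtain ⟨z, hz⟩ := mk (2 * r) x.1 (by omega) (by omega)
      exact ⟨y, z, hy, hz⟩
    · obtain ⟨y, hy⟩ := mk (2 * r) (s - s / 2 + x.1) (by omega) (by omega)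
      obtain ⟨z, hz⟩ := mk (2 * r + 1) x.1 (by omega) (by omega)
      exact ⟨y, z, hy, hz⟩
    · obtain ⟨y, hy⟩ := mk p (s - s / 2 + x.1) (by omega) (by omega)
      obtain ⟨z, hz⟩ := mk (2 * r + 1) (s / 2 + x.1) (by omega) (by omega)
      exact ⟨y, z, hy, hz⟩
  choose X Y hXY using hX
  refine many_of_pairs huv ?_ X Y ?_ ?_ ?_
  · simp only [Fintype.card_sum, Fintype.card_prod, Fintype.card_fin, hcard]
    omega
  · rintro a
    have := hXY a
    rw [hu, hv]
    change GP i i _ _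
    rcases a with ⟨⟨q, hq⟩, x⟩ | x | x | x
    · rw [this.1.1, this.2.1]
      exact GP.pair rfl (by simp only at *; omega) (by simp only at *; omega)
    · rw [this.1.1, this.2.1]
      rw [hpdef]
      exact GP.same (by omega)
    · rw [this.1.1, this.2.1]
      exact GP.pair rfl hri hri
    · rw [this.1.1, this.2.1]
      rw [hpdef]
      exact GP.same (by omega)
  · intro a e
    have := hXY a
    rw [Fin.ext_iff] at e
    rcases a with ⟨⟨q, hq⟩, x⟩ | x | x | x <;> simp only at this <;> omega
  · intro a b hab
    have h1 := hXY a
    have h2 := hXY b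
    suffices H : ((X a).1.1 ≠ (X b).1.1 ∨ (X a).2.1 ≠ (X b).2.1) ∧
        ((X a).1.1 ≠ (Y b).1.1 ∨ (X a).2.1 ≠ (Y b).2.1) ∧
        ((Y a).1.1 ≠ (Y b).1.1 ∨ (Y a).2.1 ≠ (Y b).2.1) from
      ⟨ne' _ _ H.1, ne' _ _ H.2.1, ne' _ _ H.2.2⟩
    have hp2 : p / 2 = i / 2 := by omega
    rcases a with ⟨⟨q, hq⟩, x⟩ | x | x | x <;> rcases b with ⟨⟨q', hq'⟩, x'⟩ | x' | x' | x' <;>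
      simp only [ne_eq, Sum.inl.injEq, Sum.inr.injEq, Prod.mk.injEq, Subtype.mk.injEq,
        Fin.ext_iff] at hab h1 h2 <;> omega

/-- Weights for the bipartite colouring. -/
def bw {n : Fin 2 → ℕ} (k : ℕ) (u : Σ i, Fin (n i)) : Fin 4 :=
  if u.2.1 < k then 0 else if u.1 = 0 then 1 else 2

/-- The bipartite colouring. -/
def bcol {n : Fin 2 → ℕ} (k : ℕ) : Sym2 (Σ i, Fin (n i)) → Fin 4 :=
  Sym2.lift ⟨fun u v => bw k u + bw k v, fun _ _ => add_comm _ _⟩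

theorem main_bip {n : Fin 2 → ℕ} {k : ℕ} (hn : ∀ i, 2 * k ≤ n i) {u v : Σ i, Fin (n i)}
    (huv : u ≠ v) :
    ManyPaths (completeMultipartiteGraph (fun i => Fin (n i))) k (bcol k) u v := by
  -- vertex in part `i`, low half if `b`, index `a`
  let m : Fin 2 → Bool → Fin k → Σ i, Fin (n i) := fun i b a =>
    ⟨i, ⟨if b then a.1 else k + a.1, by have := hn i; have := a.2; split_ifs <;> omega⟩⟩
  have minj : ∀ i b a i' b' a', a ≠ a' → m i b a ≠ m i' b' a' := by
    intro i b a i' b' a' h e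
    have h1 : i = i' := congrArg Sigma.fst e
    subst h1
    have h2 : (m i b a).2.1 = (m i b' a').2.1 := by rw [e]
    have h3 : a.1 ≠ a'.1 := fun e => h (Fin.ext e)
    have := a.2
    have := a'.2
    simp only [m] at h2
    split_ifs at h2 <;> omega
  have mw : ∀ i b a, bw k (m i b a) = if b then 0 else if i = 0 then 1 else 2 := by
    intro i b a
    have := a.2
    cases b <;> simp [bw, m]
  let lo : (Σ i, Fin (n i)) → Bool := fun u => decide (u.2.1 < k)
  have uw : ∀ u : Σ i, Fin (n i), bw k u = if lo u then 0 else if u.1 = 0 then 1 else 2 := by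
    intro u; simp [bw, lo]
  have hcol : ∀ u v : Σ i, Fin (n i), bcol k s(u, v) = bw k u + bw k v := fun _ _ => rfl
  have nlo : ∀ u : Σ i, Fin (n i), ∀ i a, u ≠ m i (!lo u) a := by
    intro u i a e
    have e2 : u.2.1 = (m i (!lo u) a).2.1 := by rw [← e]
    have := a.2
    by_cases h : u.2.1 < k <;> simp [m, lo, h] at e2 <;> omega
  have nfst : ∀ u v : Σ i, Fin (n i), u.1 ≠ v.1 → u ≠ v := fun u v h e => h (by rw [e])
  have mfst : ∀ i b a, (m i b a).1 = i := fun _ _ _ => rfl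
  have other : ∀ i : Fin 2, 1 - i ≠ i := by decide
  have ho : ∀ i j : Fin 2, i ≠ j → j = 1 - i := by decide
  by_cases h : u.1 = v.1
  · by_cases hl : lo u = lo v
    · refine ManyPaths.of_links (ι := Fin k) (by simp)
        (fun a => {w | w = m (1 - u.1) true a ∨ w = m u.1 (!lo u) a ∨ w = m (1 - u.1) false a})
        ?_ ?_
      · intro a
        refine RLink.four huv ?_ ?_ ?_ ?_ (nlo _ _ _) ?_ ?_ ?_ ?_ ?_
        · exact (other u.1).symm
        · exact other u.1
        · exact (other u.1).symm
        · change (1 - u.1) ≠ v.1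
          rw [← h]; exact other _
        · exact nfst _ _ (other u.1).symm
        · intro e
          have h2 := congrArg (bw k) e
          rw [mw, mw] at h2
          revert h2
          generalize u.1 = i
          revert i
          decide
        · apply nfst
          rw [mfst, ← h]; exact other _
        · rw [hl]; exact (nlo _ _ _).symm
        · simp only [hcol, mw, uw, ← h, ← hl]
          generalize u.1 = i
          generalize lo u = b
          revert i b
          decide
      · rintro a b hab w hw hw'
        change _ ∨ _ at hw hw'
        rcases hw with rfl | rfl | rfl <;> rcases hw' with e | e | e <;>
          exact minj _ _ _ _ _ _ hab e
    · refine ManyPaths.of_links (ι := Fin k) (by simp)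
        (fun a => {w | w = m (1 - u.1) true a}) ?_ ?_
      · intro a
        refine RLink.two huv (other u.1).symm ?_ ?_
        · change (1 - u.1) ≠ v.1
          rw [← h]; exact other _
        · simp only [hcol, mw, uw, ← h]
          revert hl
          generalize u.1 = i
          generalize lo u = b
          generalize lo v = b'
          revert i b b'
          decide
      · rintro a b hab w rfl e
        exact minj _ _ _ _ _ _ hab e
  · refine ManyPaths.of_links (ι := Fin k) (by simp)
        (fun a => {w | w = m v.1 (!lo v) a ∨ w = m u.1 (!lo u) a}) ?_ ?_
    · intro a
      have hh : [bcol k s(u, m v.1 (!lo v) a), bcol k s(m v.1 (!lo v) a, m u.1 (!lo u) a),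
          bcol k s(m u.1 (!lo u) a, v)].Nodup := by
        simp only [hcol, mw, uw]
        revert h
        generalize u.1 = i
        generalize v.1 = j
        generalize lo u = b
        generalize lo v = b'
        revert i j b b'
        decide
      simp only [List.nodup_cons, List.mem_cons, not_or, List.not_mem_nil, not_false_eq_true,
        and_true, List.nodup_nil] at hh
      exact RLink.three huv h (Ne.symm h) h (nlo _ _ _) (nlo _ _ _).symm hh.1.1 hh.1.2 hh.2
    · rintro a b hab w hw hw'
      change _ ∨ _ at hw hw'
      rcases hw with rfl | rfl <;> rcases hw' with e | e <;>
        exact minj _ _ _ _ _ _ hab e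

/-- For `k, t ≥ 2`, every complete `t`-partite graph all of whose parts
have size at least `⌈2k/(t-1)⌉` has `rc_k ≤ 4` when `t = 2` and `rc_k ≤ 3` when `t ≥ 3`. -/
theorem rc_k_multipartite_upper (k t : ℕ) (n : Fin t → ℕ) (hk : 2 ≤ k) (ht : 2 ≤ t)
    (hn : ∀ i, ⌈(2 * k : ℚ) / ((t : ℚ) - 1)⌉₊ ≤ n i) :
    RCle (completeMultipartiteGraph (fun i => Fin (n i))) k (if t = 2 then 4 else 3) := by
  obtain ⟨s, hs⟩ : ∃ s, s = ⌈(2 * k : ℚ) / ((t : ℚ) - 1)⌉₊ := ⟨_, rfl⟩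
  rw [← hs] at hn
  have hsk : 2 * k ≤ s * (t - 1) := by
    have h1 : (2 * k : ℚ) / ((t : ℚ) - 1) ≤ s := by rw [hs]; exact Nat.le_ceil _
    have h2 : (0 : ℚ) < (t : ℚ) - 1 := by
      have : (2 : ℚ) ≤ t := by exact_mod_cast ht
      linarith
    rw [div_le_iff₀ h2] at h1
    have h3 : ((t - 1 : ℕ) : ℚ) = (t : ℚ) - 1 := by
      rw [Nat.cast_sub (by omega)]; simp
    rw [← h3] at h1
    exact_mod_cast h1
  by_cases h2 : t = 2
  · subst h2
    rw [if_pos rfl]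
    refine ⟨bcol k, fun u v huv => main_bip (fun i => ?_) huv⟩
    have := hn i
    omega
  · rw [if_neg h2]
    refine ⟨vcol, fun u v huv => ?_⟩
    have ht3 : 3 ≤ t := by omega
    obtain ⟨m, hm⟩ : ∃ m, m = t / 2 := ⟨_, rfl⟩
    rcases Nat.mod_two_eq_zero_or_one t with hpar | hpar
    · obtain ⟨m', rfl⟩ : ∃ m', t = 2 * (m' + 2) := ⟨t / 2 - 2, by omega⟩
      have e1 : 2 * (m' + 2) / 2 = m' + 2 := by omega
      have e2 : 2 * (m' + 2) - 1 = 2 * m' + 3 := by omega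
      rw [e2] at hsk
      have e3 : s * (2 * m' + 3) = 2 * (m' * s) + 3 * s := by ring
      rw [e3] at hsk
      by_cases h : u.1 = v.1
      · refine main_same_even hn ht3 hpar ?_ huv h
        rw [e1]
        simp only [Nat.add_sub_cancel]
        omega
      · refine main_cross ht3 hn ?_ h
        rw [e1, add_mul]
        omega
    · have hk' : k ≤ t / 2 * s := by
        have e2 : t - 1 = 2 * (t / 2) := by omega
        rw [e2] at hsk
        have e3 : s * (2 * (t / 2)) = 2 * (t / 2 * s) := by ring
        omega
      by_cases h : u.1 = v.1
      · exact main_same_odd hn hpar hk' huv h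
      · exact main_cross ht3 hn hk' h
end

section
/- Let $k \ge 2$ and $t \ge 2$ be integers with $\left\lceil \frac{2k}{t-1} \right\rceil \ge 2$. Then there exist positive integers $n_1, \dots, n_t$, each at least $\left\lceil \frac{2k}{t-1} \right\rceil - 1$, such that the complete $t$-partite graph $K_{n_1, \dots, n_t}$ satisfies $\mathrm{rc}_k(K_{n_1, \dots, n_t}) \ge 5$ if $t = 2$, and $\mathrm{rc}_k(K_{n_1, \dots, n_t}) \ge 4$ if $t \ge 3$. In particular, the minimum part-size threshold $f(k,t)$ forcing $\mathrm{rc}_k \le 4$ (for $t=2$) or $\mathrm{rc}_k \le 3$ (for $t \ge 3$) equals $\left\lceil \frac{2k}{t-1} \right\rceil$. -/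
open SimpleGraph

section helpers

/-- there is a rainbow path from `u` to `v` with interior `L` -/
def GoodInt {V α : Type*} (G : SimpleGraph V) (c : Sym2 V → α) (u v : V) (L : List V) : Prop :=
  ∃ p : G.Walk u v, p.IsPath ∧ p.IsRainbow c ∧ p.support = u :: (L ++ [v])

lemma goodInt_one {V α : Type*} {G : SimpleGraph V} {c : Sym2 V → α} {u v x : V}
    (huv : u ≠ v) (h1 : G.Adj u x) (h2 : G.Adj x v) (hc : c s(u, x) ≠ c s(x, v)) :
    GoodInt G c u v [x] := by
  refine ⟨.cons h1 (.cons h2 .nil), ?_, ?_, ?_⟩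
  · have := h1.ne
    have := h2.ne
    simp [Walk.cons_isPath_iff, *]
  · simp [Walk.IsRainbow, hc]
  · simp

lemma goodInt_two {V α : Type*} {G : SimpleGraph V} {c : Sym2 V → α} {u v x y : V}
    (huv : u ≠ v) (huy : u ≠ y) (hxv : x ≠ v)
    (h1 : G.Adj u x) (h2 : G.Adj x y) (h3 : G.Adj y v)
    (hc : [c s(u, x), c s(x, y), c s(y, v)].Nodup) :
    GoodInt G c u v [x, y] := by
  refine ⟨.cons h1 (.cons h2 (.cons h3 .nil)), ?_, ?_, ?_⟩
  · have := h1.ne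
    have := h2.ne
    have := h3.ne
    simp [Walk.cons_isPath_iff, *]
  · simpa [Walk.IsRainbow] using hc
  · simp

lemma goodInt_three {V α : Type*} {G : SimpleGraph V} {c : Sym2 V → α} {u v x y z : V}
    (huv : u ≠ v) (huy : u ≠ y) (huz : u ≠ z) (hxz : x ≠ z) (hxv : x ≠ v) (hyv : y ≠ v)
    (h1 : G.Adj u x) (h2 : G.Adj x y) (h3 : G.Adj y z) (h4 : G.Adj z v)
    (hc : [c s(u, x), c s(x, y), c s(y, z), c s(z, v)].Nodup) :
    GoodInt G c u v [x, y, z] := by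
  refine ⟨.cons h1 (.cons h2 (.cons h3 (.cons h4 .nil))), ?_, ?_, ?_⟩
  · have := h1.ne
    have := h2.ne
    have := h3.ne
    have := h4.ne
    simp [Walk.cons_isPath_iff, *]
  · simpa [Walk.IsRainbow] using hc
  · simp

lemma exists_paths {V α : Type*} {G : SimpleGraph V} {c : Sym2 V → α} {u v : V} {k : ℕ}
    {ι : Type*} [Fintype ι] (hk : k ≤ Fintype.card ι) (L : ι → List V)
    (hne : ∀ i, L i ≠ []) (hL : ∀ i, GoodInt G c u v (L i))
    (hd : ∀ i j w, w ∈ L i → w ∈ L j → i = j) :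
    ∃ P : Fin k → G.Walk u v,
    Function.Injective P ∧
    (∀ i, (P i).IsPath ∧ (P i).IsRainbow c) ∧
    (∀ i j, i ≠ j → ∀ w, w ∈ (P i).support → w ∈ (P j).support → w = u ∨ w = v) := by
  classical
  choose P hP hR hS using hL
  obtain ⟨e⟩ : Nonempty (Fin k ↪ ι) := by
    apply Function.Embedding.nonempty_of_card_le
    simpa using hk
  refine ⟨fun i => P (e i), ?_, fun i => ⟨hP _, hR _⟩, ?_⟩
  · intro i j hij
    apply e.injective
    have h : (P (e i)).support = (P (e j)).support := by
      simp only at hij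
      rw [hij]
    rw [hS, hS] at h
    have h' : L (e i) = L (e j) := by simpa using h
    obtain ⟨w, hw⟩ := List.exists_mem_of_ne_nil _ (hne (e i))
    exact hd _ _ w hw (h' ▸ hw)
  · intro i j hij w hi hj
    rw [hS] at hi hj
    simp only [List.mem_cons, List.mem_append, List.not_mem_nil, or_false] at hi hj
    by_contra! hcon
    have h1 : w ∈ L (e i) := by tauto
    have h2 : w ∈ L (e j) := by tauto
    exact hij (e.injective (hd _ _ w h1 h2))

/-- lower bound -/
lemma not_RCle_of_lt (k t q ℓ : ℕ) (ht : 2 ≤ t) (hq : 0 < q) (h : (t - 1) * q < 2 * k) :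
    ∃ n : Fin t → ℕ, (∀ i, 0 < n i) ∧ (∀ i, q ≤ n i) ∧
      ¬ RCle (completeMultipartiteGraph (fun i => Fin (n i))) k ℓ := by
  classical
  let z : Fin t := ⟨0, by omega⟩
  let N := q + ℓ ^ (t * q) + 1
  let n : Fin t → ℕ := fun i => if i = z then N else q
  have hnz : n z = N := by simp [n]
  have hn : ∀ i, i ≠ z → n i = q := fun i hi => by simp [n, hi]
  refine ⟨n, ?_, ?_, ?_⟩
  · intro i; by_cases hi : i = z
    · rw [hi, hnz]; simp [N]
    · rw [hn i hi]; exact hq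
  · intro i; by_cases hi : i = z
    · rw [hi, hnz]; simp only [N]; omega
    · rw [hn i hi]
  rintro ⟨c, hc⟩
  let U : Fin N → (Σ i, Fin (n i)) := fun s => ⟨z, Fin.cast hnz.symm s⟩
  let X : {i : Fin t // i ≠ z} × Fin q → (Σ i, Fin (n i)) :=
    fun p => ⟨p.1.1, Fin.cast (hn _ p.1.2).symm p.2⟩
  have hXs : ∀ w : (Σ i, Fin (n i)), w.1 ≠ z → ∃ p, X p = w := by
    rintro ⟨i, x⟩ hi
    exact ⟨(⟨i, hi⟩, Fin.cast (hn _ hi) x), by simp [X]⟩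
  obtain ⟨a, b, hab, hcode⟩ : ∃ a b : Fin N, a ≠ b ∧
      (fun p => c s(U a, X p)) = (fun p => c s(U b, X p)) := by
    apply Fintype.exists_ne_map_eq_of_card_lt (fun a => (fun p => c s(U a, X p)))
    have hcard : Fintype.card ({i : Fin t // i ≠ z} × Fin q) = (t - 1) * q := by
      simp
    rw [Fintype.card_fun, hcard, Fintype.card_fin, Fintype.card_fin]
    rcases Nat.eq_zero_or_pos ℓ with h0 | h0
    · subst h0
      have : 0 ^ ((t-1) * q) ≤ 1 := Nat.pow_le_one_iff (by
        have : 0 < (t - 1) * q := Nat.mul_pos (by omega) hq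
        omega) |>.2 (by omega)
      have h2 : 0 ^ (t * q) = 0 := Nat.zero_pow (Nat.mul_pos (by omega) hq)
      simp only [N, h2]; omega
    · have : ℓ ^ ((t-1) * q) ≤ ℓ ^ (t * q) :=
        Nat.pow_le_pow_right h0 (Nat.mul_le_mul_right _ (by omega))
      simp only [N]; omega
  have huv : U a ≠ U b := by
    intro hE
    apply hab
    simpa [U] using hE
  obtain ⟨P, -, hP, hD⟩ := hc (U a) (U b) huv
  have hnil : ∀ i, ¬ (P i).Nil := fun i hh => huv hh.eq
  have hs : ∀ i, (P i).snd.1 ≠ z := fun i => by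
    have := (P i).adj_snd (hnil i)
    exact fun h => this h.symm
  have hp : ∀ i, (P i).penultimate.1 ≠ z := fun i => by
    have := (P i).adj_penultimate (hnil i)
    exact fun h => this h
  have hne : ∀ i, (P i).snd ≠ (P i).penultimate := by
    intro i hE
    have h1 : s(U a, (P i).snd) ∈ (P i).edges := Walk.mk_start_snd_mem_edges (hnil i)
    have h2 : s((P i).penultimate, U b) ∈ (P i).edges := Walk.mk_penultimate_end_mem_edges (hnil i)
    rw [← hE] at h2
    obtain ⟨p, hpX⟩ := hXs _ (hs i)
    have h3 : c s(U a, (P i).snd) = c s((P i).snd, U b) := by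
      rw [Sym2.eq_swap (a := (P i).snd), ← hpX]
      exact congrFun hcode p
    have h4 := List.inj_on_of_nodup_map (hP i).2 h1 h2 h3
    rw [Sym2.eq_swap (a := (P i).snd)] at h4
    exact huv (Sym2.congr_left.1 h4)
  have hUz : ∀ s, (U s).1 = z := fun _ => rfl
  let F : Fin k ⊕ Fin k → {w : (Σ i, Fin (n i)) // w.1 ≠ z} :=
    Sum.elim (fun i => ⟨(P i).snd, hs i⟩) (fun i => ⟨(P i).penultimate, hp i⟩)
  have key : ∀ i j w, w.1 ≠ z → w ∈ (P i).support → w ∈ (P j).support → i = j := by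
    intro i j w hw h1 h2
    by_contra hij
    rcases hD i j hij w h1 h2 with h | h <;> exact hw (by rw [h])
  have hm1 : ∀ i, (P i).snd ∈ (P i).support := fun i => Walk.getVert_mem_support _ _
  have hm2 : ∀ i, (P i).penultimate ∈ (P i).support := fun i => Walk.getVert_mem_support _ _
  have hF : Function.Injective F := by
    rintro (i | i) (j | j) hij
    · have h : (P i).snd = (P j).snd := congrArg Subtype.val hij
      rw [key i j _ (hs i) (hm1 i) (h ▸ hm1 j)]
    · have h : (P i).snd = (P j).penultimate := congrArg Subtype.val hij
      have e := key i j _ (hs i) (hm1 i) (h ▸ hm2 j)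
      subst e
      exact absurd h (hne i)
    · have h : (P i).penultimate = (P j).snd := congrArg Subtype.val hij
      have e := key i j _ (hp i) (hm2 i) (h ▸ hm1 j)
      subst e
      exact absurd h.symm (hne i)
    · have h : (P i).penultimate = (P j).penultimate := congrArg Subtype.val hij
      rw [key i j _ (hp i) (hm2 i) (h ▸ hm2 j)]
  have c1 := Fintype.card_le_of_injective F hF
  have c2 : Fintype.card {w : (Σ i, Fin (n i)) // w.1 ≠ z} ≤
      Fintype.card ({i : Fin t // i ≠ z} × Fin q) := by
    choose g hg using hXs
    apply Fintype.card_le_of_injective (fun w => g w.1 w.2)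
    intro w w' hw
    apply Subtype.ext
    rw [← hg w.1 w.2, ← hg w'.1 w'.2]
    exact congrArg X hw
  have hcard : Fintype.card ({i : Fin t // i ≠ z} × Fin q) = (t - 1) * q := by
    simp
  rw [hcard] at c2
  simp only [Fintype.card_sum, Fintype.card_fin] at c1
  omega


/-- vertices by coordinates -/
def mkV {t r : ℕ} {n : Fin t → ℕ} (hn : ∀ i, r ≤ n i) (i : Fin t) (s : Fin r) :
    Σ i, Fin (n i) := ⟨i, s.castLE (hn i)⟩

lemma mkV_inj {t r : ℕ} {n : Fin t → ℕ} {hn : ∀ i, r ≤ n i} {i j : Fin t} {s s' : Fin r} :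
    mkV hn i s = mkV hn j s' ↔ i = j ∧ s = s' := by
  constructor
  · intro h
    have h1 : i = j := congrArg Sigma.fst h
    subst h1
    have h2 : s.castLE (hn i) = s'.castLE (hn i) := by simpa [mkV] using h
    exact ⟨rfl, by simpa using h2⟩
  · rintro ⟨rfl, rfl⟩; rfl

/-- weight of vertex in the bipartite colouring -/
def wt2 {n : Fin 2 → ℕ} (k : ℕ) (v : Σ i, Fin (n i)) : ℕ :=
  (if v.2.val < k then 0 else 1) * (if v.1 = 0 then 1 else 2)

def col2 {n : Fin 2 → ℕ} (k : ℕ) : Sym2 (Σ i, Fin (n i)) → Fin 4 :=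
  Sym2.lift ⟨fun u v => Fin.ofNat 4 (wt2 k u + wt2 k v), fun u v => by simp only [add_comm]⟩

/-- index with given bit -/
def bidx {k : ℕ} (b : Bool) (s : Fin k) : Fin (2 * k) :=
  ⟨s.val + (if b then k else 0), by split <;> omega⟩

lemma bidx_inj {k : ℕ} {b : Bool} {s s' : Fin k} (h : bidx b s = bidx b s') : s = s' := by
  simp only [bidx, Fin.mk.injEq] at h
  exact Fin.ext (by omega)

def bitV {n : Fin 2 → ℕ} (k : ℕ) (v : Σ i, Fin (n i)) : Bool := decide (k ≤ v.2.val)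

lemma bitV_mk {n : Fin 2 → ℕ} {k : ℕ} (hn : ∀ i, 2 * k ≤ n i) (i : Fin 2) (b : Bool) (s : Fin k) :
    bitV k (mkV hn i (bidx b s)) = b := by
  have := s.2
  cases b
  · simp only [bitV, mkV, bidx, Fin.val_castLE, decide_eq_false_iff_not]
    simp
  · simp [bitV, mkV, bidx]

def colF (i : Fin 2) (b : Bool) (j : Fin 2) (d : Bool) : Fin 4 :=
  Fin.ofNat 4 (((if b then 1 else 0) * (if i = 0 then 1 else 2)) +
    ((if d then 1 else 0) * (if j = 0 then 1 else 2)))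

lemma col2_eq {n : Fin 2 → ℕ} (k : ℕ) (u v : Σ i, Fin (n i)) :
    col2 k s(u, v) = colF u.1 (bitV k u) v.1 (bitV k v) := by
  have : ∀ v : Σ i, Fin (n i), wt2 k v = (if bitV k v then 1 else 0) * (if v.1 = 0 then 1 else 2) := by
    intro v
    unfold wt2 bitV
    by_cases h : v.2.val < k
    · simp [h, not_le.2 h]
    · simp [h, not_lt.1 h]
  simp [col2, colF, this]

lemma RCle_two (k : ℕ) (n : Fin 2 → ℕ) (hn : ∀ i, 2 * k ≤ n i) :
    RCle (completeMultipartiteGraph (fun i => Fin (n i))) k 4 := by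
  refine ⟨col2 k, ?_⟩
  intro u v huv
  have hfst : ∀ i s, (mkV hn i s).1 = i := fun _ _ => rfl
  have hadj : ∀ x y : Σ i, Fin (n i), x.1 ≠ y.1 →
    (completeMultipartiteGraph (fun i => Fin (n i))).Adj x y := fun x y h => h
  have nebit : ∀ x y : Σ i, Fin (n i), bitV k x ≠ bitV k y → x ≠ y := fun x y h e => h (by rw [e])
  have nefst : ∀ x y : Σ i, Fin (n i), x.1 ≠ y.1 → x ≠ y := fun x y h e => h (by rw [e])
  have hi : ∀ i : Fin 2, 1 - i ≠ i := by decide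
  have hi' : ∀ i : Fin 2, i ≠ 1 - i := by decide
  have hb : ∀ b : Bool, b ≠ !b := by decide
  have hb' : ∀ b : Bool, (!b) ≠ b := by decide
  by_cases h1 : u.1 = v.1
  · by_cases h2 : bitV k u = bitV k v
    · apply exists_paths (ι := Fin k) (by simp)
        (fun s => [mkV hn (1 - u.1) (bidx false s), mkV hn u.1 (bidx (!bitV k u) s),
          mkV hn (1 - u.1) (bidx true s)])
      · simp
      · intro s
        apply goodInt_three huv
        · apply nebit; rw [bitV_mk]; exact hb _
        · apply nefst; exact hi' _
        · apply nebit; rw [bitV_mk, bitV_mk]; decide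
        · apply nefst; rw [← h1]; exact hi _
        · apply nebit; rw [bitV_mk, ← h2]; exact hb' _
        · apply hadj; exact hi' _
        · apply hadj; exact hi _
        · apply hadj; exact hi' _
        · apply hadj; rw [← h1]; exact hi _
        · simp only [col2_eq, bitV_mk, hfst, ← h1, ← h2]
          generalize bitV k u = b
          generalize u.1 = i
          revert i b; decide
      · intro s s' w hw hw'
        simp only [List.mem_cons, List.not_mem_nil, or_false] at hw hw'
        rcases hw with rfl | rfl | rfl <;> rcases hw' with h | h | h <;>
          first
          | exact bidx_inj (mkV_inj.1 h).2
          | exact absurd (mkV_inj.1 h).1 (hi _)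
          | exact absurd (mkV_inj.1 h).1 (hi' _)
          | (have := congrArg (bitV k) h; rw [bitV_mk, bitV_mk] at this; simp at this)
    · apply exists_paths (ι := Fin k) (by simp)
        (fun s => [mkV hn (1 - u.1) (bidx false s)])
      · simp
      · intro s
        apply goodInt_one huv
        · apply hadj; exact hi' _
        · apply hadj; rw [← h1]; exact hi _
        · simp only [col2_eq, bitV_mk, hfst, ← h1]
          revert h2
          generalize bitV k u = b
          generalize bitV k v = b'
          generalize u.1 = i
          revert i b b'; decide
      · intro s s' w hw hw'
        simp only [List.mem_cons, List.not_mem_nil, or_false] at hw hw'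
        subst hw
        exact bidx_inj (mkV_inj.1 hw').2
  · apply exists_paths (ι := Fin k) (by simp)
        (fun s => [mkV hn v.1 (bidx (!bitV k v) s), mkV hn u.1 (bidx (!bitV k u) s)])
    · simp
    · intro s
      apply goodInt_two huv
      · apply nebit; rw [bitV_mk]; exact hb _
      · apply nebit; rw [bitV_mk]; exact hb' _
      · apply hadj; exact h1
      · apply hadj; exact Ne.symm h1
      · apply hadj; exact h1
      · simp only [col2_eq, bitV_mk, hfst]
        revert h1
        generalize bitV k u = b
        generalize bitV k v = b'
        generalize u.1 = i
        generalize v.1 = j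
        revert i j b b'; decide
    · intro s s' w hw hw'
      simp only [List.mem_cons, List.not_mem_nil, or_false] at hw hw'
      rcases hw with rfl | rfl <;> rcases hw' with h | h <;>
          first
          | exact bidx_inj (mkV_inj.1 h).2
          | exact absurd (mkV_inj.1 h).1 h1
          | exact absurd (mkV_inj.1 h).1 (Ne.symm h1)

/-- colour of edges between part `a` and part `b`, at least three parts -/
def col3 (a b : ℕ) : Fin 3 :=
  if a / 2 = b / 2 then 2 else if (a + b) % 2 = 0 then 0 else 1

lemma col3_comm (a b : ℕ) : col3 a b = col3 b a := by
  unfold col3; rw [add_comm]; simp only [eq_comm]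

lemma col3_pair {a b w : ℕ} (ha : a / 2 ≠ w) (hb : b / 2 ≠ w) (hab : a % 2 = b % 2) :
    [col3 a (2 * w), col3 (2 * w) (2 * w + 1), col3 (2 * w + 1) b].Nodup := by
  have e1 : (2 * w) / 2 = w := by omega
  have e2 : (2 * w + 1) / 2 = w := by omega
  have e3 : w ≠ b / 2 := Ne.symm hb
  rcases Nat.mod_two_eq_zero_or_one a with h | h
  · have e4 : (a + 2 * w) % 2 = 0 := by omega
    have e5 : (2 * w + 1 + b) % 2 = 1 := by omega
    simp [col3, e1, e2, e3, ha, e4, e5]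
  · have e4 : (a + 2 * w) % 2 = 1 := by omega
    have e5 : (2 * w + 1 + b) % 2 = 0 := by omega
    simp [col3, e1, e2, e3, ha, e4, e5]

lemma col3_single {a b l : ℕ} (ha : l / 2 ≠ a / 2) (hb : l / 2 ≠ b / 2) (hab : a % 2 ≠ b % 2) :
    col3 a l ≠ col3 l b := by
  have ha' := Ne.symm ha
  rcases Nat.mod_two_eq_zero_or_one (a + l) with h | h
  · have e5 : (l + b) % 2 = 1 := by omega
    simp [col3, ha', hb, h, e5]
  · have e5 : (l + b) % 2 = 0 := by omega
    simp [col3, ha', hb, h, e5]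

lemma col3_partner {a b l : ℕ} (ha : l / 2 = a / 2) (hb : l / 2 ≠ b / 2) :
    col3 a l ≠ col3 l b := by
  simp only [col3, ha.symm, hb, if_true, if_false]
  split_ifs <;> decide

lemma col3_triangle {i j m : ℕ} (h1 : j / 2 = i / 2) (h2 : j ≠ i) (h3 : m / 2 ≠ i / 2) :
    [col3 i j, col3 j m, col3 m i].Nodup := by
  have h4 := Ne.symm h3
  rcases Nat.mod_two_eq_zero_or_one (j + m) with h | h
  · have e5 : (m + i) % 2 = 1 := by omega
    simp [col3, h1, h3, h4, h, e5]
  · have e5 : (m + i) % 2 = 0 := by omega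
    simp [col3, h1, h3, h4, h, e5]

def col3E {t : ℕ} {n : Fin t → ℕ} : Sym2 (Σ i, Fin (n i)) → Fin 3 :=
  Sym2.lift ⟨fun u v => col3 u.1.val v.1.val, fun u v => col3_comm _ _⟩

lemma mk_paths3 {t r k : ℕ} {n : Fin t → ℕ} (hn : ∀ i, r ≤ n i) {u v : Σ i, Fin (n i)}
    (huv : u ≠ v) {ι : Type*} [Fintype ι] (hk : k ≤ Fintype.card ι) (L : ι → List (ℕ × ℕ))
    (hL : ∀ x, (∃ p, L x = [p] ∧ (p.1 < t ∧ p.2 < r) ∧ (p.1 ≠ u.1.val ∧ p.1 ≠ v.1.val) ∧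
        col3 u.1 p.1 ≠ col3 p.1 v.1) ∨
      (∃ p q, L x = [p, q] ∧ (p.1 < t ∧ p.2 < r ∧ q.1 < t ∧ q.2 < r) ∧
        (p.1 ≠ u.1.val ∧ p.1 ≠ v.1.val ∧ q.1 ≠ u.1.val ∧ q.1 ≠ v.1.val ∧ p.1 ≠ q.1) ∧
        [col3 u.1 p.1, col3 p.1 q.1, col3 q.1 v.1].Nodup))
    (hd : ∀ x y p, p ∈ L x → p ∈ L y → x = y) :
    ∃ P : Fin k → (completeMultipartiteGraph (fun i => Fin (n i))).Walk u v,
    Function.Injective P ∧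
    (∀ i, (P i).IsPath ∧ (P i).IsRainbow col3E) ∧
    (∀ i j, i ≠ j → ∀ w, w ∈ (P i).support → w ∈ (P j).support → w = u ∨ w = v) := by
  let M : ℕ × ℕ → Σ i, Fin (n i) := fun p =>
    if h : p.1 < t ∧ p.2 < r then mkV hn ⟨p.1, h.1⟩ ⟨p.2, h.2⟩ else u
  have hM : ∀ p : ℕ × ℕ, p.1 < t → p.2 < r → (M p).1.val = p.1 := by
    intro p h1 h2
    simp [M, h1, h2, mkV]
  have hMi : ∀ p q : ℕ × ℕ, p.1 < t → p.2 < r → q.1 < t → q.2 < r → M p = M q → p = q := by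
    intro p q h1 h2 h3 h4 h
    simp only [M, h1, h2, h3, h4, and_self, dite_true] at h
    have := mkV_inj.1 h
    simp only [Fin.mk.injEq] at this
    exact Prod.ext this.1 this.2
  have hB : ∀ x, ∀ p ∈ L x, p.1 < t ∧ p.2 < r := by
    intro x p hp
    rcases hL x with ⟨a, h, hb, -⟩ | ⟨a, b, h, hb, -⟩
    · rw [h] at hp
      simp only [List.mem_cons, List.not_mem_nil, or_false] at hp
      subst hp; exact hb
    · rw [h] at hp
      simp only [List.mem_cons, List.not_mem_nil, or_false] at hp
      rcases hp with rfl | rfl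
      · exact ⟨hb.1, hb.2.1⟩
      · exact hb.2.2
  have hadj : ∀ x y : Σ i, Fin (n i), x.1.val ≠ y.1.val →
    (completeMultipartiteGraph (fun i => Fin (n i))).Adj x y :=
      fun x y h e => h (congrArg Fin.val e)
  have nefst : ∀ x y : Σ i, Fin (n i), x.1.val ≠ y.1.val → x ≠ y := fun x y h e => h (by rw [e])
  have hcol : ∀ x y : Σ i, Fin (n i), col3E s(x, y) = col3 x.1 y.1 := fun _ _ => rfl
  apply exists_paths hk (fun x => (L x).map M)
  · intro x
    rcases hL x with ⟨a, h, -⟩ | ⟨a, b, h, -⟩ <;> simp [h]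
  · intro x
    rcases hL x with ⟨p, h, hb, hne, hc⟩ | ⟨p, q, h, hb, hne, hc⟩
    · have e := hM p hb.1 hb.2
      simp only [h, List.map]
      apply goodInt_one huv
      · apply hadj; rw [e]; exact Ne.symm hne.1
      · apply hadj; rw [e]; exact hne.2
      · rw [hcol, hcol, e]; exact hc
    · have e := hM p hb.1 hb.2.1
      have e' := hM q hb.2.2.1 hb.2.2.2
      simp only [h, List.map]
      apply goodInt_two huv
      · apply nefst; rw [e']; exact Ne.symm hne.2.2.1
      · apply nefst; rw [e]; exact hne.2.1
      · apply hadj; rw [e]; exact Ne.symm hne.1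
      · apply hadj; rw [e, e']; exact hne.2.2.2.2
      · apply hadj; rw [e']; exact hne.2.2.2.1
      · rw [hcol, hcol, hcol, e, e']; exact hc
  · intro x y w hx hy
    rw [List.mem_map] at hx hy
    obtain ⟨p, hp, rfl⟩ := hx
    obtain ⟨q, hq, e⟩ := hy
    have h1 := hB x p hp
    have h2 := hB y q hq
    have := hMi q p h2.1 h2.2 h1.1 h1.2 e
    subst this
    exact hd x y q hp hq

/-- partner of a part -/
def prt (a : ℕ) : ℕ := if a % 2 = 0 then a + 1 else a - 1

lemma prt_spec (a : ℕ) : prt a / 2 = a / 2 ∧ prt a ≠ a := by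
  unfold prt; split_ifs <;> omega

lemma RCle_three (k t r : ℕ) (ht : 3 ≤ t) (hkr : 2 * k ≤ (t - 1) * r) (n : Fin t → ℕ)
    (hn : ∀ i, r ≤ n i) :
    RCle (completeMultipartiteGraph (fun i => Fin (n i))) k 3 := by
  classical
  refine ⟨col3E, ?_⟩
  intro u v huv
  have hu := u.1.2
  have hv := v.1.2
  have half : k ≤ t / 2 * r := by
    have : (t - 1) * r ≤ 2 * (t / 2) * r := Nat.mul_le_mul_right _ (by omega)
    have e : 2 * (t / 2) * r = 2 * (t / 2 * r) := by ring
    omega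
  by_cases h1 : u.1.val = v.1.val
  · generalize hI : u.1.val = i at *
    obtain ⟨pr1, pr2⟩ := prt_spec i
    rcases Nat.even_or_odd' t with ⟨m, hm | hm⟩
    · -- even number of parts
      obtain ⟨q, hq, hqi⟩ : ∃ q, q < m ∧ q ≠ i / 2 := by
        by_cases h0 : i / 2 = 0
        · exact ⟨1, by omega, by omega⟩
        · exact ⟨0, by omega, by omega⟩
      let a := r / 2
      apply mk_paths3 (r := r) hn huv (ι := ({w : Fin m // w.val ≠ q} × Fin r) ⊕ Fin a) ?_
        (Sum.elim
          (fun x => if x.1.1.val = i / 2 then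
              [(prt i, x.2.val), (if x.2.val < a then 2 * q else 2 * q + 1, x.2.val)]
            else [(2 * x.1.1.val, x.2.val), (2 * x.1.1.val + 1, x.2.val)])
          (fun s => [(2 * q, a + s.val), (2 * q + 1, s.val)]))
      · rintro (⟨⟨w, hwq⟩, s⟩ | s)
        · right
          have hw := w.2
          have hs := s.2
          simp only [Sum.elim_inl, hI, ← h1]
          by_cases hwi : w.val = i / 2
          · simp only [hwi, if_true]
            refine ⟨_, _, rfl, ?_, ?_, ?_⟩
            · simp only
              split_ifs <;> omega
            · simp only
              split_ifs <;> omega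
            · apply col3_triangle pr1 pr2
              simp only
              split_ifs <;> omega
          · simp only [hwi, if_false]
            refine ⟨_, _, rfl, ?_, ?_, ?_⟩
            · simp only
              omega
            · simp only
              omega
            · exact col3_pair (Ne.symm hwi) (Ne.symm hwi) rfl
        · right
          have hs := s.2
          simp only [Sum.elim_inr, hI, ← h1]
          refine ⟨_, _, rfl, ?_, ?_, ?_⟩
          · simp only
            omega
          · simp only
            omega
          · exact col3_pair (Ne.symm hqi) (Ne.symm hqi) rfl
      · rintro (⟨⟨w, hwq⟩, s⟩ | s) (⟨⟨w', hwq'⟩, s'⟩ | s') ⟨b, c⟩ hx hy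
        · have hww : w.val = w'.val ∧ s.val = s'.val := by
            simp only [Sum.elim_inl] at hx hy
            by_cases g : w.val = i / 2 <;> by_cases g' : w'.val = i / 2 <;>
              simp only [g, g', if_true, if_false, List.mem_cons, List.not_mem_nil, or_false,
                Prod.mk.injEq] at hx hy <;> (try split_ifs at hx) <;> (try split_ifs at hy) <;> omega
          have e1 : w = w' := Fin.ext hww.1
          have e2 : s = s' := Fin.ext hww.2
          subst e1 e2; rfl
        · exfalso
          have := s'.2
          simp only [Sum.elim_inl, Sum.elim_inr] at hx hy
          by_cases g : w.val = i / 2 <;>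
              simp only [g, if_true, if_false, List.mem_cons, List.not_mem_nil, or_false,
                Prod.mk.injEq] at hx hy <;> (try split_ifs at hx) <;> omega
        · exfalso
          have := s.2
          simp only [Sum.elim_inl, Sum.elim_inr] at hx hy
          by_cases g : w'.val = i / 2 <;>
              simp only [g, if_true, if_false, List.mem_cons, List.not_mem_nil, or_false,
                Prod.mk.injEq] at hx hy <;> (try split_ifs at hy) <;> omega
        · have : s.val = s'.val := by
            simp only [Sum.elim_inr, List.mem_cons, List.not_mem_nil, or_false,
                Prod.mk.injEq] at hx hy
            omega
          rw [Fin.ext this]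
      · have hcard : Fintype.card {w : Fin m // w.val ≠ q} = m - 1 := by
          have : Fintype.card {w : Fin m // w.val ≠ q} =
              Fintype.card {w : Fin m // w ≠ ⟨q, hq⟩} :=
            Fintype.card_congr (Equiv.subtypeEquivRight (fun w => by simp [Fin.ext_iff]))
          rw [this]; simp
        rw [Fintype.card_sum, Fintype.card_prod, hcard, Fintype.card_fin, Fintype.card_fin]
        have e : (t - 1) * r = 2 * ((m - 1) * r) + r := by
          obtain ⟨m', rfl⟩ : ∃ m', m = m' + 1 := ⟨m - 1, by omega⟩
          have : t - 1 = 2 * m' + 1 := by omega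
          rw [this, Nat.add_sub_cancel]; ring
        omega
    · -- odd number of parts
      apply mk_paths3 (r := r) hn huv (ι := Fin (t / 2) × Fin r) (by simpa using half)
        (fun x => if x.1.val = i / 2 then [(prt i, x.2.val), (t - 1, x.2.val)]
            else [(2 * x.1.val, x.2.val), (2 * x.1.val + 1, x.2.val)])
      · rintro ⟨w, s⟩
        right
        have hw := w.2
        have hs := s.2
        simp only [hI, ← h1]
        by_cases hwi : w.val = i / 2
        · simp only [hwi, if_true]
          refine ⟨_, _, rfl, ?_, ?_, ?_⟩
          · simp only
            omega
          · simp only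
            omega
          · apply col3_triangle pr1 pr2
            simp only
            omega
        · simp only [hwi, if_false]
          refine ⟨_, _, rfl, ?_, ?_, ?_⟩
          · simp only
            omega
          · simp only
            omega
          · exact col3_pair (Ne.symm hwi) (Ne.symm hwi) rfl
      · rintro ⟨w, s⟩ ⟨w', s'⟩ ⟨b, c⟩ hx hy
        have hw := w.2
        have hw' := w'.2
        have hww : w.val = w'.val ∧ s.val = s'.val := by
          simp only at hx hy
          by_cases g : w.val = i / 2 <;> by_cases g' : w'.val = i / 2 <;>
            simp only [g, g', if_true, if_false, List.mem_cons, List.not_mem_nil, or_false,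
              Prod.mk.injEq] at hx hy <;> omega
        exact Prod.ext (Fin.ext hww.1) (Fin.ext hww.2)
  · generalize hI : u.1.val = i at *
    generalize hJ : v.1.val = j at *
    obtain ⟨pi1, pi2⟩ := prt_spec i
    obtain ⟨pj1, pj2⟩ := prt_spec j
    by_cases h2 : i / 2 = j / 2
    · -- partners
      apply mk_paths3 (r := r) hn huv (ι := {l : Fin t // l ∉ ({u.1, v.1} : Finset (Fin t))} × Fin r) ?_
        (fun x => [(x.1.1.val, x.2.val)])
      · rintro ⟨⟨l, hl⟩, s⟩
        left
        have hl1 : l.val ≠ i ∧ l.val ≠ j := by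
          simp only [Finset.mem_insert, Finset.mem_singleton, not_or, Fin.ext_iff, hI, hJ] at hl
          exact hl
        refine ⟨_, rfl, ⟨l.2, s.2⟩, ?_, ?_⟩
        · rw [hI, hJ]; exact hl1
        · rw [hI, hJ]; exact col3_single (by simp only; omega) (by simp only; omega) (by omega)
      · rintro ⟨⟨l, hl⟩, s⟩ ⟨⟨l', hl'⟩, s'⟩ ⟨b, c⟩ hx hy
        simp only [List.mem_cons, List.not_mem_nil, or_false, Prod.mk.injEq] at hx hy
        have e1 : l = l' := Fin.ext (by omega)
        have e2 : s = s' := Fin.ext (by omega)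
        subst e1 e2; rfl
      · have hne : u.1 ≠ v.1 := fun e => h1 (by rw [← hI, ← hJ, e])
        have hcard : Fintype.card {l : Fin t // l ∉ ({u.1, v.1} : Finset (Fin t))} = t - 2 := by
          rw [Fintype.card_subtype_compl, Fintype.card_coe, Finset.card_pair hne, Fintype.card_fin]
        rw [Fintype.card_prod, hcard, Fintype.card_fin]
        have : (t - 1) * r ≤ 2 * (t - 2) * r := Nat.mul_le_mul_right _ (by omega)
        have e : 2 * (t - 2) * r = 2 * ((t - 2) * r) := by ring
        omega
    · apply mk_paths3 (r := r) hn huv (ι := Fin (t / 2) × Fin r) (by simpa using half)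
        (fun x => if x.1.val = i / 2 then [(prt i, x.2.val)]
            else if x.1.val = j / 2 then [(prt j, x.2.val)]
            else if i % 2 = j % 2 then [(2 * x.1.val, x.2.val), (2 * x.1.val + 1, x.2.val)]
            else [(2 * x.1.val, x.2.val)])
      · rintro ⟨w, s⟩
        have hw := w.2
        have hs := s.2
        simp only [hI, hJ]
        by_cases g1 : w.val = i / 2
        · left
          simp only [g1, if_true]
          refine ⟨_, rfl, ?_, ?_, col3_partner pi1 (by simp only; omega)⟩ <;> simp only <;> omega
        by_cases g2 : w.val = j / 2
        · left
          simp only [g1, if_false, g2, if_true, Ne.symm h2]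
          refine ⟨_, rfl, ?_, ?_, ?_⟩
          · simp only; omega
          · simp only; omega
          · rw [col3_comm i, col3_comm _ j]
            exact (col3_partner pj1 (by omega)).symm
        by_cases g3 : i % 2 = j % 2
        · right
          simp only [g1, g2, g3, if_false, if_true]
          refine ⟨_, _, rfl, ?_, ?_, col3_pair (Ne.symm g1) (Ne.symm g2) g3⟩ <;> simp only <;> omega
        · left
          simp only [g1, g2, g3, if_false]
          refine ⟨_, rfl, ?_, ?_, col3_single ?_ ?_ g3⟩ <;> simp only <;> omega
      · rintro ⟨w, s⟩ ⟨w', s'⟩ ⟨b, c⟩ hx hy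
        have key : ∀ (w : Fin (t / 2)) (s : Fin r), (b, c) ∈ (if w.val = i / 2 then [(prt i, s.val)]
            else if w.val = j / 2 then [(prt j, s.val)]
            else if i % 2 = j % 2 then [(2 * w.val, s.val), (2 * w.val + 1, s.val)]
            else [(2 * w.val, s.val)]) → w.val = b / 2 ∧ s.val = c := by
          intro w s h
          split_ifs at h <;>
            simp only [List.mem_cons, List.not_mem_nil, or_false, Prod.mk.injEq] at h <;> omega
        have e1 := key w s hx
        have e2 := key w' s' hy
        exact Prod.ext (Fin.ext (by simp only; omega)) (Fin.ext (by simp only; omega))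

end helpers

/-- For `k, t ≥ 2` with `⌈2k/(t-1)⌉ ≥ 2`, there is a complete `t`-partite
graph with all parts of size at least `⌈2k/(t-1)⌉ - 1` whose rainbow `k`-connection number
is at least `5` when `t = 2` and at least `4` when `t ≥ 3`.  Consequently the least
part-size threshold `f(k,t)` forcing `rc_k ≤ 4` (for `t = 2`) resp. `rc_k ≤ 3`
(for `t ≥ 3`) equals `⌈2k/(t-1)⌉`. -/
theorem f_eq_ceil (k t : ℕ) (hk : 2 ≤ k) (ht : 2 ≤ t)
    (hc : 2 ≤ ⌈(2 * k : ℚ) / ((t : ℚ) - 1)⌉₊) :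
    (∃ n : Fin t → ℕ, (∀ i, 0 < n i) ∧
      (∀ i, ⌈(2 * k : ℚ) / ((t : ℚ) - 1)⌉₊ - 1 ≤ n i) ∧
      ¬ RCle (completeMultipartiteGraph (fun i => Fin (n i))) k (if t = 2 then 4 else 3)) ∧
    sInf {r : ℕ | ∀ n : Fin t → ℕ, (∀ i, 0 < n i) → (∀ i, r ≤ n i) →
        RCle (completeMultipartiteGraph (fun i => Fin (n i))) k (if t = 2 then 4 else 3)}
      = ⌈(2 * k : ℚ) / ((t : ℚ) - 1)⌉₊ := by
  have ht1 : (0 : ℚ) < (t : ℚ) - 1 := by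
    have : (2 : ℚ) ≤ t := by exact_mod_cast ht
    linarith
  have hcast : ((t - 1 : ℕ) : ℚ) = (t : ℚ) - 1 := by
    rw [Nat.cast_sub (by omega)]; simp
  generalize hr : ⌈(2 * k : ℚ) / ((t : ℚ) - 1)⌉₊ = r at *
  have hup : 2 * k ≤ (t - 1) * r := by
    have h := Nat.le_ceil ((2 * k : ℚ) / ((t : ℚ) - 1))
    rw [hr, div_le_iff₀ ht1, ← hcast] at h
    have h' : 2 * k ≤ r * (t - 1) := by exact_mod_cast h
    rwa [mul_comm (t - 1)]
  have hlo : (t - 1) * (r - 1) < 2 * k := by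
    have h : r - 1 < ⌈(2 * k : ℚ) / ((t : ℚ) - 1)⌉₊ := by omega
    rw [Nat.lt_ceil, lt_div_iff₀ ht1, ← hcast] at h
    have h' : (r - 1) * (t - 1) < 2 * k := by exact_mod_cast h
    rwa [mul_comm (t - 1)]
  have hlow := not_RCle_of_lt k t (r - 1) (if t = 2 then 4 else 3) ht (by omega) hlo
  refine ⟨hlow, ?_⟩
  apply le_antisymm
  · apply Nat.sInf_le
    intro n _ hn
    by_cases h2 : t = 2
    · subst h2
      exact RCle_two k n (fun i => le_trans (by omega) (hn i))
    · rw [if_neg h2]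
      exact RCle_three k t r (by omega) hup n hn
  · apply le_csInf
    · refine ⟨r, ?_⟩
      intro n _ hn
      by_cases h2 : t = 2
      · subst h2
        exact RCle_two k n (fun i => le_trans (by omega) (hn i))
      · rw [if_neg h2]
        exact RCle_three k t r (by omega) hup n hn
    · intro b hb
      by_contra! hlt
      obtain ⟨n, h0, h1, h2⟩ := hlow
      exact h2 (hb n h0 (fun i => le_trans (by omega) (h1 i)))
end

section
/- Let $t, n_1, n_2, \dots, n_t$ be positive integers with $t \ge 3$, and suppose that $\mathrm{rc}_2(K_{n_1, n_2, \dots, n_t}) = 2$. Then $\mathrm{rc}_2(K_{n_1 + 1, n_2 + 1, n_3, \dots, n_t}) = 2$; that is, the complete $t$-partite graph obtained by enlarging two of the parts by one vertex each also has rainbow $2$-connection number $2$. -/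
open SimpleGraph

/-- Middle vertex of a rainbow path of length two. -/
def Mid {V : Type*} (G : SimpleGraph V) (c : Sym2 V → Fin 2) (u z v : V) : Prop :=
  G.Adj u z ∧ G.Adj z v ∧ c s(u, z) ≠ c s(z, v)

/-- Combinatorial form of rainbow 2-connectedness with two colors. -/
def GoodCol {V : Type*} (G : SimpleGraph V) (c : Sym2 V → Fin 2) : Prop :=
  ∀ u v : V, u ≠ v → (∃ z, Mid G c u z v ∧ (G.Adj u v ∨ ∃ z', z' ≠ z ∧ Mid G c u z' v))

theorem walk_short {V : Type*} {G : SimpleGraph V} (c : Sym2 V → Fin 2) {u v : V} (huv : u ≠ v)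
    (p : G.Walk u v) (hp : p.IsRainbow c) :
    (∃ h : G.Adj u v, p = Walk.cons h Walk.nil) ∨ ∃ z, Mid G c u z v ∧ z ∈ p.support := by
  have hl := List.Nodup.length_le_card hp
  simp at hl
  cases p with
  | nil => exact absurd rfl huv
  | cons h q =>
    cases q with
    | nil => exact Or.inl ⟨h, rfl⟩
    | cons h' r =>
      cases r with
      | nil =>
        right
        refine ⟨_, ⟨h, h', ?_⟩, by simp⟩
        simpa [Walk.IsRainbow] using hp
      | cons h'' s => simp at hl

theorem good_of_rc {V : Type*} {G : SimpleGraph V} (c : Sym2 V → Fin 2)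
    (h : IsRainbowConnectedColoring G 2 c) : GoodCol G c := by
  intro u v huv
  obtain ⟨P, hinj, hP, hd⟩ := h u v huv
  rcases walk_short c huv (P 0) (hP 0).2 with ⟨h0, e0⟩ | ⟨z, hz, hz'⟩ <;>
  rcases walk_short c huv (P 1) (hP 1).2 with ⟨h1, e1⟩ | ⟨w, hw, hw'⟩
  · exact absurd (hinj (e0.trans e1.symm)) (by decide)
  · exact ⟨w, hw, Or.inl h0⟩
  · exact ⟨z, hz, Or.inl h1⟩
  · refine ⟨z, hz, Or.inr ⟨w, ?_, hw⟩⟩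
    rintro rfl
    rcases hd 0 1 (by decide) w hz' hw' with r | r
    · exact hz.1.ne r.symm
    · exact hz.2.1.ne r

theorem rc_of_good {V : Type*} {G : SimpleGraph V} (c : Sym2 V → Fin 2)
    (h : GoodCol G c) : IsRainbowConnectedColoring G 2 c := by
  intro u v huv
  obtain ⟨z, hz, h'⟩ := h u v huv
  have key : ∃ Q R : G.Walk u v, Q ≠ R ∧ (Q.IsPath ∧ Q.IsRainbow c) ∧ (R.IsPath ∧ R.IsRainbow c) ∧
      ∀ w, w ∈ Q.support → w ∈ R.support → w = u ∨ w = v := by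
    have hzp : (Walk.cons hz.1 (Walk.cons hz.2.1 Walk.nil)).IsPath := by
      have := hz.1.ne
      have := hz.2.1.ne
      simp; tauto
    have hzr : (Walk.cons hz.1 (Walk.cons hz.2.1 Walk.nil)).IsRainbow c := by
      simpa [Walk.IsRainbow] using hz.2.2
    rcases h' with ha | ⟨w, hne, hw⟩
    · refine ⟨Walk.cons hz.1 (Walk.cons hz.2.1 Walk.nil), Walk.cons ha Walk.nil, ?_,
        ⟨hzp, hzr⟩, ⟨?_, ?_⟩, ?_⟩
      · intro e
        have := congrArg Walk.length e
        simp at this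
      · simpa using huv
      · simp [Walk.IsRainbow]
      · intro w _ hw
        simpa using hw
    · have hwp : (Walk.cons hw.1 (Walk.cons hw.2.1 Walk.nil)).IsPath := by
        have := hw.1.ne
        have := hw.2.1.ne
        simp; tauto
      have hwr : (Walk.cons hw.1 (Walk.cons hw.2.1 Walk.nil)).IsRainbow c := by
        simpa [Walk.IsRainbow] using hw.2.2
      refine ⟨Walk.cons hz.1 (Walk.cons hz.2.1 Walk.nil),
        Walk.cons hw.1 (Walk.cons hw.2.1 Walk.nil), ?_, ⟨hzp, hzr⟩, ⟨hwp, hwr⟩, ?_⟩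
      · intro e
        have := congrArg Walk.support e
        simp at this
        exact hne this.symm
      · intro x hx hx'
        simp at hx hx'
        grind
  obtain ⟨Q, R, hne, hQ, hR, hd⟩ := key
  refine ⟨![Q, R], ?_, ?_, ?_⟩
  · intro i j hij
    fin_cases i <;> fin_cases j <;> simp_all
  · intro i
    fin_cases i
    · exact hQ
    · exact hR
  · intro i j hij w hi hj
    fin_cases i <;> fin_cases j
    · exact absurd rfl hij
    · exact hd w hi hj
    · exact hd w hj hi
    · exact absurd rfl hij

theorem not_rc_one {V : Type*} {G : SimpleGraph V} (u v : V) (huv : u ≠ v) : ¬ RCle G 2 1 := by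
  rintro ⟨c, h⟩
  obtain ⟨P, hinj, hP, -⟩ := h u v huv
  have key : ∀ p : G.Walk u v, p.IsRainbow c → ∃ h : G.Adj u v, p = Walk.cons h Walk.nil := by
    intro p hp
    have hl := List.Nodup.length_le_card hp
    simp at hl
    cases p with
    | nil => exact absurd rfl huv
    | cons h q =>
      cases q with
      | nil => exact ⟨h, rfl⟩
      | cons h' r => simp at hl
  obtain ⟨_, e0⟩ := key _ (hP 0).2
  obtain ⟨_, e1⟩ := key _ (hP 1).2
  exact absurd (hinj (e0.trans e1.symm)) (by decide)

theorem mid_symm {V : Type*} {G : SimpleGraph V} {c : Sym2 V → Fin 2} {u z v : V}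
    (h : Mid G c u z v) : Mid G c v z u := by
  refine ⟨h.2.1.symm, h.1.symm, ?_⟩
  rw [Sym2.eq_swap (a := v), Sym2.eq_swap (b := u)]
  exact h.2.2.symm

theorem good_new_old {V W ι : Type*} {G : SimpleGraph V} {H : SimpleGraph W} (p : V → ι)
    (hG : ∀ u v, G.Adj u v ↔ p u ≠ p v) (q : W → ι) (hH : ∀ u v, H.Adj u v ↔ q u ≠ q v)
    (f : W → V) (e : V → W) (hfe : ∀ v, f (e v) = v)
    (x y : W) (hy : ∀ v, e v ≠ y) (a b : V) (hb : f y = b) (hab : p a ≠ p b)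
    (qe : ∀ v, q (e v) = p v) (qx : q x = p a) (qy : q y = p b)
    (c : Sym2 V → Fin 2) (hc : GoodCol G c) (c' : Sym2 W → Fin 2)
    (c1 : ∀ u v, c' s(e u, e v) = c s(u, v))
    (c2 : ∀ v, v ≠ b → c' s(x, e v) = c s(a, v))
    (c3 : c' s(x, e b) = c s(a, b) + 1)
    (c4 : ∀ v, v ≠ a → c' s(y, e v) = c s(b, v))
    (c5 : c' s(y, e a) = c s(a, b) + 1)
    (c6 : c' s(x, y) = c s(a, b)) (v : V) :
    ∃ z, Mid H c' x z (e v) ∧ (H.Adj x (e v) ∨ ∃ z', z' ≠ z ∧ Mid H c' x z' (e v)) := by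
  have hne1 : ∀ r : Fin 2, r ≠ r + 1 := by decide
  by_cases hv : v = a
  · subst hv
    refine ⟨y, ⟨?_, ?_, ?_⟩, Or.inr ⟨e b, hy b, ?_, ?_, ?_⟩⟩
    · rw [hH, qx, qy]; exact hab
    · rw [hH, qe, qy]; exact hab.symm
    · rw [c6, c5]; exact hne1 _
    · rw [hH, qx, qe]; exact hab
    · rw [hH, qe, qe]; exact hab.symm
    · rw [c3, c1, Sym2.eq_swap (a := b)]; exact (hne1 _).symm
  · have key : ∀ z, Mid G c a z v → ∃ z', f z' = z ∧ Mid H c' x z' (e v) := by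
      rintro z ⟨h1, h2, h3⟩
      rw [hG] at h1 h2
      by_cases hz : z = b
      · subst hz
        refine ⟨y, hb, ?_, ?_, ?_⟩
        · rw [hH, qx, qy]; exact h1
        · rw [hH, qe, qy]; exact h2
        · rw [c6, c4 v hv]; exact h3
      · refine ⟨e z, hfe z, ?_, ?_, ?_⟩
        · rw [hH, qx, qe]; exact h1
        · rw [hH, qe, qe]; exact h2
        · rw [c2 z hz, c1]; exact h3
    obtain ⟨z, hz, h⟩ := hc a v (Ne.symm hv)
    obtain ⟨z', e1, hz'⟩ := key z hz
    refine ⟨z', hz', ?_⟩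
    rcases h with h | ⟨w, hne, hw⟩
    · left; rw [hH, qx, qe]; exact (hG _ _).1 h
    · obtain ⟨w', e2, hw'⟩ := key w hw
      refine Or.inr ⟨w', ?_, hw'⟩
      rintro rfl
      exact hne (e2.symm.trans e1)

/-- Extension step: `x` is a twin of `a`, `y` is a twin of `b`, with the edges `xb`, `ay` flipped. -/
theorem good_extend {V W ι : Type*} {G : SimpleGraph V} {H : SimpleGraph W} (p : V → ι)
    (hG : ∀ u v, G.Adj u v ↔ p u ≠ p v) (q : W → ι) (hH : ∀ u v, H.Adj u v ↔ q u ≠ q v)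
    (f : W → V) (e : V → W) (hfe : ∀ v, f (e v) = v) (hqp : ∀ w, q w = p (f w))
    (x y : W) (hx : ∀ v, e v ≠ x) (hy : ∀ v, e v ≠ y)
    (hcov : ∀ w, (∃ v, w = e v) ∨ w = x ∨ w = y) (hab : p (f x) ≠ p (f y))
    (c : Sym2 V → Fin 2) (hc : GoodCol G c) : ∃ c' : Sym2 W → Fin 2, GoodCol H c' := by
  classical
  obtain ⟨a, ha⟩ : ∃ a, f x = a := ⟨_, rfl⟩
  obtain ⟨b, hb⟩ : ∃ b, f y = b := ⟨_, rfl⟩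
  have hxy : x ≠ y := by rintro rfl; exact hab rfl
  rw [ha, hb] at hab
  have hne : a ≠ b := by rintro rfl; exact hab rfl
  obtain ⟨c', hc'⟩ : ∃ c' : Sym2 W → Fin 2, c' = fun s => c (s.map f) +
    if s = s(x, e b) ∨ s = s(e a, y) then 1 else 0 := ⟨_, rfl⟩
  have einj : ∀ u v, e u = e v → u = v := fun u v h => by rw [← hfe u, h, hfe]
  have hx' : ∀ v, x ≠ e v := fun v => (hx v).symm
  have hy' : ∀ v, y ≠ e v := fun v => (hy v).symm
  have c1 : ∀ u v, c' s(e u, e v) = c s(u, v) := by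
    intro u v; simp [hc', hfe, hx, hy]
  have c2 : ∀ v, v ≠ b → c' s(x, e v) = c s(a, v) := by
    intro v hv
    have : e v ≠ e b := fun h => hv (einj _ _ h)
    simp [hc', hfe, hx, hx', hy, hxy, this, ha]
  have c3 : c' s(x, e b) = c s(a, b) + 1 := by simp [hc', hfe, ha]
  have c4 : ∀ v, v ≠ a → c' s(y, e v) = c s(b, v) := by
    intro v hv
    have : e v ≠ e a := fun h => hv (einj _ _ h)
    simp [hc', hfe, hx, hy', hy, hxy.symm, this, hb]
  have c5 : c' s(y, e a) = c s(a, b) + 1 := by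
    simp [hc', hfe, hb, Sym2.eq_swap]
  have c6 : c' s(x, y) = c s(a, b) := by
    simp [hc', hfe, ha, hb, hx', hy', hxy, hxy.symm]
  clear hc'
  have qe : ∀ v, q (e v) = p v := fun v => by rw [hqp, hfe]
  have qx : q x = p a := by rw [hqp, ha]
  have qy : q y = p b := by rw [hqp, hb]
  have goodx := good_new_old p hG q hH f e hfe x y hy a b hb hab qe qx qy c hc c' c1 c2 c3 c4 c5 c6
  have goody := good_new_old p hG q hH f e hfe y x hx b a ha hab.symm qe qy qx c hc c' c1 c4
    (by rw [c5, Sym2.eq_swap (a := a)]) c2 (by rw [c3, Sym2.eq_swap (a := a)])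
    (by rw [Sym2.eq_swap, c6, Sym2.eq_swap])
  have goodxy : ∃ z, Mid H c' x z y ∧ (H.Adj x y ∨ ∃ z', z' ≠ z ∧ Mid H c' x z' y) := by
    obtain ⟨z, ⟨h1, h2, h3⟩, -⟩ := hc a b hne
    refine ⟨e z, ⟨?_, ?_, ?_⟩, Or.inl ?_⟩
    · rw [hH, qx, qe]; exact (hG _ _).1 h1
    · rw [hH, qe, qy]; exact (hG _ _).1 h2
    · rw [c2 z h2.ne, Sym2.eq_swap (b := y), c4 z h1.ne', Sym2.eq_swap (a := b)]; exact h3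
    · rw [hH, qx, qy]; exact hab
  have goode : ∀ u v, u ≠ v → ∃ z, Mid H c' (e u) z (e v) ∧
      (H.Adj (e u) (e v) ∨ ∃ z', z' ≠ z ∧ Mid H c' (e u) z' (e v)) := by
    intro u v huv
    have key : ∀ z, Mid G c u z v → Mid H c' (e u) (e z) (e v) := by
      rintro z ⟨h1, h2, h3⟩
      refine ⟨?_, ?_, ?_⟩
      · rw [hH, qe, qe]; exact (hG _ _).1 h1
      · rw [hH, qe, qe]; exact (hG _ _).1 h2
      · rw [c1, c1]; exact h3
    obtain ⟨z, hz, h⟩ := hc u v huv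
    refine ⟨e z, key z hz, ?_⟩
    rcases h with h | ⟨w, hw, hw'⟩
    · left; rw [hH, qe, qe]; exact (hG _ _).1 h
    · exact Or.inr ⟨e w, fun h => hw (einj _ _ h), key w hw'⟩
  have symm : ∀ u v, (∃ z, Mid H c' u z v ∧ (H.Adj u v ∨ ∃ z', z' ≠ z ∧ Mid H c' u z' v)) →
      (∃ z, Mid H c' v z u ∧ (H.Adj v u ∨ ∃ z', z' ≠ z ∧ Mid H c' v z' u)) := by
    rintro u v ⟨z, hz, h⟩
    refine ⟨z, mid_symm hz, ?_⟩
    rcases h with h | ⟨w, hw, hw'⟩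
    · exact Or.inl h.symm
    · exact Or.inr ⟨w, hw, mid_symm hw'⟩
  refine ⟨c', fun u v huv => ?_⟩
  rcases hcov u with ⟨u, rfl⟩ | rfl | rfl <;> rcases hcov v with ⟨v, rfl⟩ | rfl | rfl
  · exact goode u v (fun h => huv (h ▸ rfl))
  · exact symm _ _ (goodx u)
  · exact symm _ _ (goody u)
  · exact goodx v
  · exact absurd rfl huv
  · exact goodxy
  · exact goody v
  · exact symm _ _ goodxy
  · exact absurd rfl huv

/-- Let `t ≥ 3` and suppose the complete `t`-partite graph with parts of
sizes `n 0, …, n (t-1)` has rainbow `2`-connection number exactly `2` (a `2`-coloring works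
and no `1`-coloring does).  If `n'` is obtained from `n` by adding one vertex to each of the
first two parts, then the complete `t`-partite graph with parts of sizes `n'` also has
rainbow `2`-connection number exactly `2`. -/
theorem rc_two_stays_two (t : ℕ) (n n' : Fin t → ℕ) (ht : 3 ≤ t)
    (hn : ∀ i, 0 < n i)
    (h0 : n' ⟨0, by omega⟩ = n ⟨0, by omega⟩ + 1)
    (h1 : n' ⟨1, by omega⟩ = n ⟨1, by omega⟩ + 1)
    (hrest : ∀ i : Fin t, 2 ≤ i.1 → n' i = n i)
    (hle : RCle (completeMultipartiteGraph (fun i => Fin (n i))) 2 2)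
    (hnle : ¬ RCle (completeMultipartiteGraph (fun i => Fin (n i))) 2 1) :
    RCle (completeMultipartiteGraph (fun i => Fin (n' i))) 2 2 ∧
    ¬ RCle (completeMultipartiteGraph (fun i => Fin (n' i))) 2 1 := by
  constructor
  · obtain ⟨c, hc⟩ := hle
    have hnn : ∀ i, n i ≤ n' i := by
      intro i
      by_cases hi : 2 ≤ i.1
      · exact (hrest i hi).ge
      · obtain ⟨i, hi'⟩ := i
        have : i = 0 ∨ i = 1 := by simp at hi; omega
        rcases this with rfl | rfl <;> omega
    obtain ⟨c', hc'⟩ := good_extend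
      (G := completeMultipartiteGraph (fun i => Fin (n i)))
      (H := completeMultipartiteGraph (fun i => Fin (n' i)))
      Sigma.fst (fun u v => Iff.rfl) Sigma.fst (fun u v => Iff.rfl)
      (fun w => ⟨w.1, if h : w.2.1 < n w.1 then ⟨w.2.1, h⟩ else ⟨0, hn _⟩⟩)
      (fun v => ⟨v.1, Fin.castLE (hnn v.1) v.2⟩)
      (by rintro ⟨i, k⟩; simp)
      (by intro w; rfl)
      ⟨⟨0, by omega⟩, ⟨n ⟨0, by omega⟩, by omega⟩⟩
      ⟨⟨1, by omega⟩, ⟨n ⟨1, by omega⟩, by omega⟩⟩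
      (by
        rintro ⟨i, k⟩ h
        obtain ⟨h2, h3⟩ := Sigma.mk.inj h
        dsimp only at h2
        subst h2
        have h4 := congrArg Fin.val (eq_of_heq h3)
        have := k.2
        simp at h4
        omega)
      (by
        rintro ⟨i, k⟩ h
        obtain ⟨h2, h3⟩ := Sigma.mk.inj h
        dsimp only at h2
        subst h2
        have h4 := congrArg Fin.val (eq_of_heq h3)
        have := k.2
        simp at h4
        omega)
      (by
        rintro ⟨i, k⟩
        by_cases hk : k.1 < n i
        · exact Or.inl ⟨⟨i, ⟨k.1, hk⟩⟩, rfl⟩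
        · right
          have hk2 := k.2
          by_cases hi : 2 ≤ i.1
          · have := hrest i hi
            omega
          · obtain ⟨i, hi'⟩ := i
            have : i = 0 ∨ i = 1 := by simp at hi; omega
            rcases this with rfl | rfl
            · left
              congr 1
              apply Fin.ext
              simp only
              omega
            · right
              congr 1
              apply Fin.ext
              simp only
              omega)
      (by simp)
      c (good_of_rc c hc)
    exact ⟨c', rc_of_good c' hc'⟩
  · apply not_rc_one (⟨⟨0, by omega⟩, ⟨0, by omega⟩⟩ : Σ i, Fin (n' i))
      ⟨⟨1, by omega⟩, ⟨0, by omega⟩⟩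
    intro h
    simp at h
end

section
/- Let $m, n$ be positive integers with $n \ge 2$ and $1 \le m \le 4^{\lfloor n/2 \rfloor}$. Then the rainbow $2$-connection number of the complete tripartite graph $K_{m,n,n}$ equals $2$; that is, there is an edge coloring of $K_{m,n,n}$ with $2$ colors under which every pair of distinct vertices is connected by two internally disjoint rainbow paths, and no coloring with fewer colors achieves this. -/
open SimpleGraph

/-- A middle vertex of a rainbow path of length two. -/
def RMid {V : Type*} (G : SimpleGraph V) (c : Sym2 V → Fin 2) (u v w : V) : Prop :=
  G.Adj u w ∧ G.Adj w v ∧ c s(u, w) ≠ c s(w, v)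

theorem rainbow_of_mid {V : Type*} (G : SimpleGraph V) (c : Sym2 V → Fin 2)
    (h : ∀ u v, u ≠ v → (G.Adj u v ∧ ∃ w, RMid G c u v w) ∨
      ∃ w w', w ≠ w' ∧ RMid G c u v w ∧ RMid G c u v w') :
    IsRainbowConnectedColoring G 2 c := by
  intro u v huv
  rcases h u v huv with ⟨ha, w, h1, h2, h3⟩ | ⟨w, w', hw, ⟨h1, h2, h3⟩, ⟨h4, h5, h6⟩⟩
  · refine ⟨![Walk.cons ha Walk.nil, Walk.cons h1 (Walk.cons h2 Walk.nil)], ?_, ?_, ?_⟩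
    · intro i j hij
      fin_cases i <;> fin_cases j <;> simp at hij ⊢
      · exact h2.ne hij.1.symm
      · exact h2.ne hij.1
    · intro i
      fin_cases i <;>
        simp [Walk.IsRainbow, huv, h1.ne, h2.ne, h3]
    · intro i j hij x
      fin_cases i <;> fin_cases j <;> simp at hij ⊢ <;> tauto
  · refine ⟨![Walk.cons h1 (Walk.cons h2 Walk.nil), Walk.cons h4 (Walk.cons h5 Walk.nil)],
      ?_, ?_, ?_⟩
    · intro i j hij
      fin_cases i <;> fin_cases j <;> simp at hij ⊢
      · exact hw hij.1
      · exact hw hij.1.symm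
    · intro i
      fin_cases i <;>
        simp [Walk.IsRainbow, huv, h1.ne, h2.ne, h3, h4.ne, h5.ne, h6]
    · intro i j hij x
      fin_cases i <;> fin_cases j <;> simp at hij ⊢ <;> grind

theorem long_of_not_adj {V : Type*} {G : SimpleGraph V} {u v : V} (huv : u ≠ v)
    (ha : ¬ G.Adj u v) (p : G.Walk u v) (hp : p.length ≤ 1) : False := by
  cases p with
  | nil => exact huv rfl
  | cons h q =>
    cases q with
    | nil => exact ha h
    | cons h' r => simp at hp

theorem exists_code (m n : ℕ) (hm : 1 ≤ m) (hn : 2 ≤ n) (hmu : m ≤ 4 ^ (n / 2)) :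
    ∃ (f g : Fin m → Fin n → Bool) (a₀ : Fin m),
      (∀ a a', a ≠ a' → (∃ i j, i ≠ j ∧ f a i ≠ f a' i ∧ f a j ≠ f a' j) ∨
        (∃ i j, i ≠ j ∧ g a i ≠ g a' i ∧ g a j ≠ g a' j)) ∧
      (∀ a i, ∃ j, f a j ≠ decide (i = j)) ∧
      (∀ a i, ∃ j, g a j ≠ decide (i = j)) ∧
      (∀ i, f a₀ i = false) ∧ (∀ i, g a₀ i = true) := by
  obtain ⟨k, hk⟩ : ∃ k, k = n / 2 := ⟨_, rfl⟩
  have hk1 : 1 ≤ k := by omega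
  let h : Fin n → Fin k := fun i => ⟨min (i.val / 2) (k - 1), by omega⟩
  have hpair : ∀ i, ∃ i', i ≠ i' ∧ h i' = h i := by
    intro i
    by_cases hi : i.val % 2 = 0 ∧ i.val + 1 < n
    · refine ⟨⟨i.val + 1, hi.2⟩, ?_, ?_⟩
      · simp [Fin.ext_iff]
      · simp only [h, Fin.ext_iff]; omega
    · refine ⟨⟨i.val - 1, by omega⟩, ?_, ?_⟩
      · simp only [ne_eq, Fin.ext_iff]; omega
      · simp only [h, Fin.ext_iff]; omega
  have hsurj : ∀ t, ∃ i, h i = t := by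
    intro t
    refine ⟨⟨2 * t.val, by omega⟩, ?_⟩
    simp only [h, Fin.ext_iff]; omega
  have hcard : Fintype.card (Fin m) ≤ Fintype.card ((Fin k → Bool) × (Fin k → Bool)) := by
    simp only [Fintype.card_fin, Fintype.card_prod, Fintype.card_fun, Fintype.card_bool]
    rw [← mul_pow, hk]; exact hmu
  obtain ⟨e⟩ := Function.Embedding.nonempty_of_card_le hcard
  let a₀ : Fin m := ⟨0, hm⟩
  let T : (Fin k → Bool) × (Fin k → Bool) := (fun _ => false, fun _ => true)
  let φ : Fin m → (Fin k → Bool) × (Fin k → Bool) := fun a => Equiv.swap (e a₀) T (e a)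
  have hφ : Function.Injective φ := (Equiv.injective _).comp e.injective
  have hφ0 : φ a₀ = T := Equiv.swap_apply_left _ _
  have hdec : ∀ (y : Fin k → Bool) (i : Fin n), ∃ j, y (h j) ≠ decide (i = j) := by
    intro y i
    by_contra! hc
    obtain ⟨i', hi, hh⟩ := hpair i
    have h1 := hc i
    have h2 := hc i'
    rw [hh, h1] at h2
    simp [hi] at h2
  have hdiff : ∀ y y' : Fin k → Bool, y ≠ y' →
      ∃ i j, i ≠ j ∧ y (h i) ≠ y' (h i) ∧ y (h j) ≠ y' (h j) := by
    intro y y' hy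
    obtain ⟨t, ht⟩ := Function.ne_iff.mp hy
    obtain ⟨i, rfl⟩ := hsurj t
    obtain ⟨j, hij, hj⟩ := hpair i
    exact ⟨i, j, hij, ht, by rw [hj]; exact ht⟩
  refine ⟨fun a i => (φ a).1 (h i), fun a i => (φ a).2 (h i), a₀, ?_, ?_, ?_, ?_, ?_⟩
  · intro a a' ha
    by_cases h1 : (φ a).1 = (φ a').1
    · right
      apply hdiff
      intro h2
      exact ha (hφ (Prod.ext h1 h2))
    · left
      exact hdiff _ _ h1
  · intro a i; exact hdec _ i
  · intro a i; exact hdec _ i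
  · intro i; simp only [hφ0, T]
  · intro i; simp only [hφ0, T]

/-- The vertices as a sum type. -/
def toS (m n : ℕ) : (Σ i, ![Fin m, Fin n, Fin n] i) → Fin m ⊕ Fin n ⊕ Fin n
  | ⟨0, a⟩ => Sum.inl a
  | ⟨1, b⟩ => Sum.inr (Sum.inl b)
  | ⟨2, c⟩ => Sum.inr (Sum.inr c)

/-- The colour of a pair. -/
def colS {m n : ℕ} (f g : Fin m → Fin n → Bool) :
    Fin m ⊕ Fin n ⊕ Fin n → Fin m ⊕ Fin n ⊕ Fin n → Bool
  | Sum.inl a, Sum.inr (Sum.inl b) => f a b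
  | Sum.inr (Sum.inl b), Sum.inl a => f a b
  | Sum.inl a, Sum.inr (Sum.inr b) => g a b
  | Sum.inr (Sum.inr b), Sum.inl a => g a b
  | Sum.inr (Sum.inl b), Sum.inr (Sum.inr c) => decide (b = c)
  | Sum.inr (Sum.inr c), Sum.inr (Sum.inl b) => decide (b = c)
  | _, _ => false

theorem colS_symm {m n : ℕ} (f g : Fin m → Fin n → Bool) (x y) :
    colS f g x y = colS f g y x := by
  rcases x with x | x | x <;> rcases y with y | y | y <;> rfl

/-- The edge colouring. -/
def theCol {m n : ℕ} (f g : Fin m → Fin n → Bool) :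
    Sym2 (Σ i, ![Fin m, Fin n, Fin n] i) → Fin 2 :=
  Sym2.lift ⟨fun u v => if colS f g (toS m n u) (toS m n v) then 1 else 0, fun u v => by
    simp only [colS_symm f g (toS m n u)]⟩

theorem rmid_iff {m n : ℕ} (f g : Fin m → Fin n → Bool) (u v w : Σ i, ![Fin m, Fin n, Fin n] i) :
    RMid (completeMultipartiteGraph ![Fin m, Fin n, Fin n]) (theCol f g) u v w ↔
      u.1 ≠ w.1 ∧ w.1 ≠ v.1 ∧
        colS f g (toS m n u) (toS m n w) ≠ colS f g (toS m n w) (toS m n v) := by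
  unfold RMid theCol
  simp only [Sym2.lift_mk]
  refine and_congr Iff.rfl (and_congr Iff.rfl ?_)
  cases colS f g (toS m n u) (toS m n w) <;> cases colS f g (toS m n w) (toS m n v) <;> simp

theorem rc_two_Kmnn_eq_two (m n : ℕ) (hm : 1 ≤ m) (hn : 2 ≤ n) (hmu : m ≤ 4 ^ (n / 2)) :
    RCle (completeMultipartiteGraph ![Fin m, Fin n, Fin n]) 2 2 ∧
    ¬ RCle (completeMultipartiteGraph ![Fin m, Fin n, Fin n]) 2 1 := by
  constructor
  · obtain ⟨f, g, a₀, hd, hf, hg, hf0, hg0⟩ := exists_code m n hm hn hmu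
    refine ⟨theCol f g, rainbow_of_mid _ _ ?_⟩
    let A : Fin m → (Σ i, ![Fin m, Fin n, Fin n] i) := fun a => ⟨0, a⟩
    let B : Fin n → (Σ i, ![Fin m, Fin n, Fin n] i) := fun a => ⟨1, a⟩
    let C : Fin n → (Σ i, ![Fin m, Fin n, Fin n] i) := fun a => ⟨2, a⟩
    have hA : ∀ a, toS m n (A a) = Sum.inl a := fun _ => rfl
    have hB : ∀ a, toS m n (B a) = Sum.inr (Sum.inl a) := fun _ => rfl
    have hC : ∀ a, toS m n (C a) = Sum.inr (Sum.inr a) := fun _ => rfl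
    have A1 : ∀ a, (A a).1 = 0 := fun _ => rfl
    have B1 : ∀ a, (B a).1 = 1 := fun _ => rfl
    have C1 : ∀ a, (C a).1 = 2 := fun _ => rfl
    have hBi : ∀ i j, i ≠ j → B i ≠ B j := by
      intro i j hij he
      have := congrArg (toS m n) he
      simp [hB] at this
      exact hij this
    have hCi : ∀ i j, i ≠ j → C i ≠ C j := by
      intro i j hij he
      have := congrArg (toS m n) he
      simp [hC] at this
      exact hij this
    have cases3 : ∀ u, (∃ a, u = A a) ∨ (∃ a, u = B a) ∨ (∃ a, u = C a) := by
      rintro ⟨i, x⟩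
      fin_cases i
      · exact Or.inl ⟨x, rfl⟩
      · exact Or.inr (Or.inl ⟨x, rfl⟩)
      · exact Or.inr (Or.inr ⟨x, rfl⟩)
    intro u v huv
    have hadj : ∀ u v : (Σ i, ![Fin m, Fin n, Fin n] i),
      (completeMultipartiteGraph ![Fin m, Fin n, Fin n]).Adj u v ↔ u.1 ≠ v.1 := fun _ _ => Iff.rfl
    simp only [rmid_iff, hadj]
    rcases cases3 u with ⟨a, rfl⟩ | ⟨a, rfl⟩ | ⟨a, rfl⟩ <;>
      rcases cases3 v with ⟨b, rfl⟩ | ⟨b, rfl⟩ | ⟨b, rfl⟩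
    · right
      have hab : a ≠ b := fun h => huv (by rw [h])
      rcases hd a b hab with ⟨i, j, hij, h1, h2⟩ | ⟨i, j, hij, h1, h2⟩
      · exact ⟨B i, B j, hBi i j hij, by simpa [A1, B1, hA, hB, colS] using h1,
          by simpa [A1, B1, hA, hB, colS] using h2⟩
      · exact ⟨C i, C j, hCi i j hij, by simpa [A1, C1, hA, hC, colS] using h1,
          by simpa [A1, C1, hA, hC, colS] using h2⟩
    · left
      obtain ⟨j, hj⟩ := hg a b
      exact ⟨by simp [A1, B1], C j, by simpa [A1, B1, C1, hA, hB, hC, colS] using hj⟩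
    · left
      obtain ⟨j, hj⟩ := hf a b
      exact ⟨by simp [A1, C1], B j, by simpa [A1, B1, C1, hA, hB, hC, colS, eq_comm] using hj⟩
    · left
      obtain ⟨j, hj⟩ := hg b a
      exact ⟨by simp [A1, B1], C j, by simpa [A1, B1, C1, hA, hB, hC, colS] using hj.symm⟩
    · right
      have hab : a ≠ b := fun h => huv (by rw [h])
      exact ⟨C a, C b, hCi a b hab, by simp [B1, C1, hB, hC, colS, hab.symm],
        by simp [B1, C1, hB, hC, colS, hab]⟩
    · left
      exact ⟨by simp [B1, C1], A a₀, by simp [A1, B1, C1, hA, hB, hC, colS, hf0, hg0]⟩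
    · left
      obtain ⟨j, hj⟩ := hf b a
      exact ⟨by simp [A1, C1], B j, by
        simpa [A1, B1, C1, hA, hB, hC, colS, eq_comm] using hj.symm⟩
    · left
      exact ⟨by simp [B1, C1], A a₀, by simp [A1, B1, C1, hA, hB, hC, colS, hf0, hg0]⟩
    · right
      have hab : a ≠ b := fun h => huv (by rw [h])
      exact ⟨B a, B b, hBi a b hab, by simp [B1, C1, hB, hC, colS, hab],
        by simp [B1, C1, hB, hC, colS, hab.symm]⟩
  · rintro ⟨c, hc⟩
    let u : (Σ i, ![Fin m, Fin n, Fin n] i) := ⟨1, (⟨0, by omega⟩ : Fin n)⟩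
    let v : (Σ i, ![Fin m, Fin n, Fin n] i) := ⟨1, (⟨1, by omega⟩ : Fin n)⟩
    have huv : u ≠ v := by
      intro h
      have := congrArg (toS m n) h
      simp [u, v, toS] at this
    obtain ⟨P, -, hP, -⟩ := hc u v huv
    have h1 := (hP 0).2
    have h2 := List.Nodup.length_le_card h1
    have hna : ¬ (completeMultipartiteGraph ![Fin m, Fin n, Fin n]).Adj u v := by
      intro h
      have h' : u.1 ≠ v.1 := h
      exact h' rfl
    exact long_of_not_adj huv hna (P 0) (by simpa using h2)
end
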